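/- Let p_1, …, p_n be distinct prime numbers and let (X, r) be an indecomposable involutive non-degenerate set-theoretic solution of the Yang–Baxter equation on a finite set X of cardinality p_1⋯p_n (equivalently, of square-free cardinality). Then (X, r) is a multipermutation solution. -/

import Mathlib

open Equiv Pointwise

universe u v

/-- An involutive non-degenerate set-theoretic solution of the Yang–Baxter equation on `X`,
presented by its family of bijections `σ x` (`x ∈ X`), subject to the condition
`σ_x ∘ σ_{σ_x⁻¹(y)} = σ_y ∘ σ_{σ_y⁻¹(x)}`; the solution itself is recovered as
`r (x, y) = (σ x y, (σ (σ x y))⁻¹ x)`. -/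
structure YBE (X : Type u) where
  σ : X → Equiv.Perm X
  ybe : ∀ x y : X, σ x * σ ((σ x)⁻¹ y) = σ y * σ ((σ y)⁻¹ x)

namespace YBE

variable {X : Type u} {Y : Type v}

/-- The permutation group `𝒢(X,r)` of a solution. -/
def permGroup (S : YBE X) : Subgroup (Equiv.Perm X) :=
  Subgroup.closure (Set.range S.σ)

/-- `(X,r)` is indecomposable if `𝒢(X,r)` acts transitively on `X`. -/
def Indecomposable (S : YBE X) : Prop :=
  ∀ x y : X, ∃ g ∈ S.permGroup, g x = y

/-- Homomorphism of solutions. -/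
def IsHom (S : YBE X) (T : YBE Y) (f : X → Y) : Prop :=
  ∀ x y : X, f (S.σ x y) = T.σ (f x) (f y)

/-- `T` is (a copy of) the retract `Ret(X,r)` of `S`: there is a surjective homomorphism
of solutions identifying points with equal `σ`'s, and only those. -/
def IsRetract (S : YBE X) (T : YBE Y) : Prop :=
  ∃ f : X → Y, Function.Surjective f ∧ S.IsHom T f ∧
    ∀ x x' : X, f x = f x' ↔ S.σ x = S.σ x'

/-- `Retⁿ(X,r)` has cardinality one, i.e. the multipermutation level is at most `n`. -/
def MPLevelLE : ℕ → (X : Type u) → YBE X → Prop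
  | 0, X, _ => Nonempty X ∧ Subsingleton X
  | n + 1, _, S => ∃ (Z : Type u) (T : YBE Z), S.IsRetract T ∧ MPLevelLE n Z T

/-- `(X,r)` is a multipermutation solution: `Retⁿ(X,r)` has cardinality one
for some positive integer `n`. -/
def IsMultipermutation (S : YBE X) : Prop :=
  ∃ n : ℕ, 0 < n ∧ MPLevelLE n X S

/-- `m` is the multipermutation level of `(X,r)`: it is the least positive integer
with `|Retᵐ(X,r)| = 1`. -/
def MPLevelExact (S : YBE X) (m : ℕ) : Prop :=
  0 < m ∧ MPLevelLE m X S ∧ ∀ k : ℕ, 0 < k → MPLevelLE k X S → m ≤ k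

/-- A simple solution: `|X| > 1` and every epimorphic image is either an isomorphic copy
or a singleton. -/
def IsSimple (S : YBE X) : Prop :=
  1 < Nat.card X ∧ ∀ (Z : Type u) (T : YBE Z) (f : X → Z),
    S.IsHom T f → Function.Surjective f → (Function.Bijective f ∨ Nat.card Z = 1)

end YBE

/-- The orbit `H(x) = {t(x) : t ∈ H}` of `x ∈ X` under a subgroup `H` of a permutation
group `G ≤ Sym(X)`. -/
def orbIn {X : Type u} {G : Subgroup (Equiv.Perm X)} (H : Subgroup ↥G) (x : X) : Set X :=
  {y | ∃ t : ↥G, t ∈ H ∧ (t : Equiv.Perm X) x = y}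

/-- The "orbit" `A(x) = {t(x) : t ∈ A}` of `x ∈ X` under a subset `A` of a permutation
group `G ≤ Sym(X)`. -/
def orbSet {X : Type u} {G : Subgroup (Equiv.Perm X)} (A : Set ↥G) (x : X) : Set X :=
  {y | ∃ t ∈ A, ((t : Equiv.Perm X)) x = y}

/-- A left-brace structure on a group `G`: an abelian group operation `add` (whose neutral
element is `1`) satisfying the brace compatibility `a∘(b+c) + a = a∘b + a∘c`, where `∘` is the
given group operation of `G`.  In other words, this makes `G` a left brace whose
multiplicative group is `G`. -/
structure BraceOps (G : Type*) [Group G] where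
  add : G → G → G
  neg : G → G
  add_assoc : ∀ a b c, add (add a b) c = add a (add b c)
  add_comm : ∀ a b, add a b = add b a
  zero_add : ∀ a, add 1 a = a
  neg_add_cancel : ∀ a, add (neg a) a = 1
  compat : ∀ a b c, add (a * add b c) a = add (a * b) (a * c)

namespace BraceOps

variable {G : Type*} [Group G]

/-- The lambda map `λ_a(b) = -a + a∘b` of a left brace. -/
def lam (β : BraceOps G) (a b : G) : G :=
  β.add (β.neg a) (a * b)

/-- Natural multiples with respect to the additive structure of the brace. -/
def nsmul (β : BraceOps G) : ℕ → G → G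
  | 0, _ => 1
  | n + 1, a => β.add a (β.nsmul n a)

/-- The socle `Soc(B) = {a : a∘b = a + b for all b}` of a left brace. -/
def socle (β : BraceOps G) : Set G :=
  {a | ∀ b : G, a * b = β.add a b}

/-- The Sylow `q`-subgroup (i.e. the `q`-primary component) of the additive group of a
finite left brace. -/
def addSylow (β : BraceOps G) (q : ℕ) : Set G :=
  {a | ∃ k : ℕ, β.nsmul (q ^ k) a = 1}

/-- `A` is a subgroup of the additive group of the brace. -/
def IsAddSubgroup (β : BraceOps G) (A : Set G) : Prop :=
  1 ∈ A ∧ (∀ a ∈ A, ∀ b ∈ A, β.add a b ∈ A) ∧ ∀ a ∈ A, β.neg a ∈ A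

/-- A left ideal of a left brace: an additive subgroup stable under all `λ_a`. -/
def IsLeftIdeal (β : BraceOps G) (L : Set G) : Prop :=
  β.IsAddSubgroup L ∧ ∀ a : G, ∀ b ∈ L, β.lam a b ∈ L

/-- An ideal of a left brace: a normal subgroup of the multiplicative group stable
under all `λ_a`. -/
def IsIdeal (β : BraceOps G) (I : Set G) : Prop :=
  1 ∈ I ∧ (∀ a ∈ I, ∀ b ∈ I, a * b ∈ I) ∧ (∀ a ∈ I, a⁻¹ ∈ I) ∧
    (∀ g : G, ∀ a ∈ I, g * a * g⁻¹ ∈ I) ∧ ∀ g : G, ∀ a ∈ I, β.lam g a ∈ I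

end BraceOps

namespace YBE

variable {X : Type u}

/-- `σ x` as an element of `𝒢(X,r)`. -/
def σg (S : YBE X) (x : X) : ↥S.permGroup :=
  ⟨S.σ x, Subgroup.subset_closure (Set.mem_range_self x)⟩

/-- The natural left-brace structure on `𝒢(X,r)`: the unique left brace structure whose
multiplicative group is `𝒢(X,r)`, whose additive group is generated by `{σ_x : x ∈ X}`,
and whose lambda map satisfies `λ_g(σ_y) = σ_{g(y)}`. -/
structure IsNaturalBrace (S : YBE X) (β : BraceOps ↥S.permGroup) : Prop where
  lam_sigma : ∀ (g : ↥S.permGroup) (y : X),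
    β.lam g (S.σg y) = S.σg ((g : Equiv.Perm X) y)
  add_gen : ∀ A : Set ↥S.permGroup, β.IsAddSubgroup A → (∀ x : X, S.σg x ∈ A) →
    ∀ g : ↥S.permGroup, g ∈ A

/-- The product `P_{τ(1)} P_{τ(2)} ⋯ P_{τ(i)}` of Sylow subgroups of the additive group of
the left brace `𝒢(X,r)`, taken inside the multiplicative group. -/
def sylProdTake (S : YBE X) (β : BraceOps ↥S.permGroup) {n : ℕ} (p : Fin n → ℕ)
    (τ : Equiv.Perm (Fin n)) (i : ℕ) : Set ↥S.permGroup :=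
  ((List.ofFn fun j : Fin n => β.addSylow (p (τ j))).take i).prod

/-- The product `P_{i+1} P_{i+2} ⋯ P_n` of Sylow subgroups of the additive group of the
left brace `𝒢(X,r)`, taken inside the multiplicative group. -/
def sylProdDrop (S : YBE X) (β : BraceOps ↥S.permGroup) {n : ℕ} (p : Fin n → ℕ)
    (i : ℕ) : Set ↥S.permGroup :=
  ((List.ofFn fun j : Fin n => β.addSylow (p j)).drop i).prod

end YBE

/-- The holomorph `ℤ/(q) ⋊ Aut(ℤ/(q))` of the cyclic group of order `q`. -/
abbrev Hol (q : ℕ) :=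
  SemidirectProduct (Multiplicative (ZMod q)) (MulAut (Multiplicative (ZMod q)))
    (MonoidHom.id (MulAut (Multiplicative (ZMod q))))

/-- Kronecker delta `δ_{u,w} ∈ ℤ/(q)`. -/
noncomputable def kdelta (q : ℕ) {α : Type v} (u w : α) : ZMod q :=
  letI := Classical.propDecidable (u = w)
  if u = w then 1 else 0

/-- The map `σ'_{(a,x)}(b,y) = (b + δ_{x,σ_x(y)}, σ_x(y))` on `ℤ/(q) × Y`. -/
noncomputable def extMap {Y : Type v} (T : YBE Y) (q : ℕ) (a b : ZMod q × Y) :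
    ZMod q × Y :=
  (b.1 + kdelta q a.2 (T.σ a.2 b.2), T.σ a.2 b.2)

theorem sum_eq_zero_or_eq_of_isIntegral_average {s : Multiset ℂ} {m : ℕ} (hm : m ≠ 0)
    (h : ∀ x ∈ s, x ^ m = 1) (h_int : IsIntegral ℤ (s.sum / s.card)) :
    s.sum = 0 ∨ ∃ z : ℂ, ∀ x ∈ s, x = z := by
  by_cases hs : s.sum = 0
  · exact Or.inl hs
  right
  have hc : (s.card : ℂ) ≠ 0 := by
    intro h0
    have : s = 0 := by simpa using h0
    simp [this] at hs
  have hcR : (0 : ℝ) < s.card := by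
    have : s.card ≠ 0 := by exact_mod_cast hc
    positivity
  set α : ℂ := s.sum / s.card with hα
  have hα0 : α ≠ 0 := div_ne_zero hs hc
  let K : IntermediateField ℚ ℂ := IntermediateField.adjoin ℚ {x : ℂ | x ^ m = 1}
  have hfin : {x : ℂ | x ^ m = 1}.Finite := by
    refine ((Polynomial.nthRoots m (1 : ℂ)).toFinset.finite_toSet).subset fun x hx => ?_
    simpa [Polynomial.mem_nthRoots (Nat.pos_of_ne_zero hm)] using hx
  have hK : FiniteDimensional ℚ K :=
    have := hfin.to_subtype
    IntermediateField.finiteDimensional_adjoin fun x hx =>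
      ⟨Polynomial.X ^ m - 1, Polynomial.monic_X_pow_sub_C 1 hm, by
        simp [show x ^ m = 1 from hx]⟩
  have : NumberField K := ⟨⟩
  have hsK : ∀ x ∈ s, x ∈ K := fun x hx => IntermediateField.subset_adjoin _ _ (h x hx)
  lift s to Multiset K using hsK
  set β : K := s.sum / s.card with hβ
  have hβα : (β : ℂ) = α := by
    have := map_multiset_sum (algebraMap K ℂ) s
    have e2 : (β : ℂ) = (algebraMap K ℂ s.sum) / s.card := by
      change algebraMap K ℂ β = _
      rw [hβ, map_div₀, map_natCast]
    rw [e2, this, hα, Multiset.card_map]; rfl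
  have hβ0 : β ≠ 0 := fun h0 => hα0 (by rw [← hβα, h0]; rfl)
  have hβint : IsIntegral ℤ β := by
    rw [← isIntegral_algebraMap_iff (algebraMap K ℂ).injective]
    change IsIntegral ℤ (β : ℂ)
    rwa [hβα]
  have hpow : ∀ x ∈ s, x ^ m = 1 := by
    intro x hx
    have := h x (Multiset.mem_map_of_mem _ hx)
    exact_mod_cast this
  obtain ⟨k, hk, hk1⟩ := NumberField.Embeddings.pow_eq_one_of_norm_le_one K ℂ hβ0 hβint (by
    intro φ
    rw [hβ, map_div₀, map_multiset_sum, map_natCast, norm_div]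
    rw [Multiset.card_map] at hcR
    rw [div_le_one (by simpa using hcR)]
    refine (norm_multiset_sum_le _).trans ?_
    rw [Multiset.map_map]
    have : s.map (norm ∘ φ) = s.map (fun _ => (1 : ℝ)) := by
      refine Multiset.map_congr rfl fun x hx => ?_
      refine Complex.norm_eq_one_of_pow_eq_one ?_ hm
      rw [← map_pow, hpow x hx, map_one]
    rw [this]
    simp)
  have hα1 : ‖α‖ = 1 := by
    refine Complex.norm_eq_one_of_pow_eq_one (n := k) ?_ (by omega)
    rw [← hβα]; exact_mod_cast hk1
  refine ⟨α, ?_⟩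
  set t : Multiset ℂ := s.map (↑) with ht
  have hconj : (starRingEnd ℂ) α * α = 1 := by
    rw [mul_comm, Complex.mul_conj, Complex.normSq_eq_norm_sq, hα1]; simp
  have hnorm : ∀ x ∈ t, ‖(starRingEnd ℂ) α * x‖ = 1 := fun x hx => by
    rw [norm_mul, Complex.norm_conj, hα1, one_mul]
    exact Complex.norm_eq_one_of_pow_eq_one (h x hx) hm
  have hle : ∀ x ∈ t, ((starRingEnd ℂ) α * x).re ≤ 1 := fun x hx =>
    (Complex.re_le_norm _).trans (hnorm x hx).le
  have hsum : (t.map fun x => ((starRingEnd ℂ) α * x).re).sum = (t.map fun _ => (1 : ℝ)).sum := by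
    have e1 : (t.map fun x => ((starRingEnd ℂ) α * x).re).sum = ((starRingEnd ℂ) α * t.sum).re := by
      rw [← Multiset.sum_map_mul_left]
      rw [← Complex.coe_reAddGroupHom, map_multiset_sum]
      simp only [ht, Multiset.map_map]; rfl
    have e2 : t.sum = α * t.card := by rw [hα]; field_simp
    rw [e1, e2, ← mul_assoc, hconj]; simp
  intro x hx
  have hre : ((starRingEnd ℂ) α * x).re = 1 := by
    by_contra hne
    exact (Multiset.sum_lt_sum hle ⟨x, hx, lt_of_le_of_ne (hle x hx) hne⟩).ne hsum
  have h1 : (starRingEnd ℂ) α * x = 1 := by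
    have hsq := Complex.sq_norm_sub_sq_re ((starRingEnd ℂ) α * x)
    rw [hnorm x hx, hre] at hsq
    apply Complex.ext
    · simpa using hre
    · simpa using hsq.symm
  have hα' : (starRingEnd ℂ) α ≠ 0 := by simpa using hα0
  exact mul_left_cancel₀ hα' (h1.trans hconj.symm)

theorem exists_eq_smul_one_of_pow_eq_one {d m : ℕ} (hm : m ≠ 0) {M : Matrix (Fin d) (Fin d) ℂ}
    (hM : M ^ m = 1) {z : ℂ} (hz : ∀ x ∈ M.charpoly.roots, x = z) : ∃ c : ℂ, M = c • 1 := by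
  classical
  have hdvd : minpoly ℂ M ∣ Polynomial.X ^ m - 1 := minpoly.dvd _ _ (by simp [hM])
  have hsep : (Polynomial.X ^ m - 1 : Polynomial ℂ).Separable :=
    Polynomial.separable_X_pow_sub_C 1 (by exact_mod_cast hm) one_ne_zero
  have hsep' := hsep.of_dvd hdvd
  have hnd := Polynomial.nodup_roots hsep'
  have hsub : (minpoly ℂ M).roots ≤ M.charpoly.roots :=
    Polynomial.roots.le_of_dvd (Matrix.charpoly_monic M).ne_zero (Matrix.minpoly_dvd_charpoly M)
  have h_int : IsIntegral ℂ M := Matrix.isIntegral M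
  have hprod := (IsAlgClosed.splits (minpoly ℂ M)).eq_prod_roots_of_monic (minpoly.monic h_int)
  have hle : (minpoly ℂ M).roots ≤ {z} := by
    rw [Multiset.le_iff_subset hnd]
    intro x hx
    simpa using hz x (Multiset.mem_of_le hsub hx)
  refine ⟨z, ?_⟩
  have hd : minpoly ℂ M ∣ Polynomial.X - Polynomial.C z := by
    rw [hprod]
    refine (Multiset.prod_dvd_prod_of_le (Multiset.map_le_map hle)).trans ?_
    simp
  have := Polynomial.aeval_eq_zero_of_dvd_aeval_eq_zero hd (minpoly.aeval ℂ M)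
  simpa [sub_eq_zero, Algebra.algebraMap_eq_smul_one] using this

theorem roots_pow_eq_one {d m : ℕ} {M : Matrix (Fin d) (Fin d) ℂ}
    (hM : M ^ m = 1) {x : ℂ} (hx : x ∈ M.charpoly.roots) : x ^ m = 1 := by
  have h1 : x ∈ spectrum ℂ M := by
    rw [Matrix.mem_spectrum_iff_isRoot_charpoly]
    exact (Polynomial.mem_roots'.1 hx).2
  have h2 := spectrum.pow_mem_pow M m h1
  rw [hM] at h2
  have : Nontrivial (Matrix (Fin d) (Fin d) ℂ) := by
    by_contra hn
    rw [not_nontrivial_iff_subsingleton] at hn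
    simp [spectrum.of_subsingleton] at h1
  rw [spectrum.one_eq] at h2
  simpa using h2

theorem trace_lmul_pi_matrix {n : ℕ} {d : Fin n → ℕ}
    (M : Π i, Matrix (Fin (d i)) (Fin (d i)) ℂ) :
    LinearMap.trace ℂ _ (Algebra.lmul ℂ (Π i, Matrix (Fin (d i)) (Fin (d i)) ℂ) M) =
      ∑ i, (d i : ℂ) * (M i).trace := by
  classical
  rw [LinearMap.trace_eq_matrix_trace ℂ
      (Pi.basis fun i => Matrix.stdBasis ℂ (Fin (d i)) (Fin (d i))), Matrix.trace,
    Fintype.sum_sigma]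
  refine Finset.sum_congr rfl fun i _ => ?_
  rw [Fintype.sum_prod_type]
  simp only [Matrix.diag, LinearMap.toMatrix_apply, Pi.basis_apply, Pi.basis_repr,
    Matrix.stdBasis_eq_single]
  have : ∀ a b : Fin (d i), ((Matrix.stdBasis ℂ (Fin (d i)) (Fin (d i))).repr
      (((Algebra.lmul ℂ (Π i, Matrix (Fin (d i)) (Fin (d i)) ℂ)) M)
        (Pi.single i (Matrix.single a b 1)) i)) (a, b) = M i a a := by
    intro a b
    simp [Matrix.stdBasis, Matrix.mul_apply, Matrix.single_apply]
  simp only [this]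
  simp [Matrix.trace, Finset.mul_sum]

theorem trace_lmul_single {G : Type*} [Group G] [Finite G] {g : G} (hg : g ≠ 1) :
    LinearMap.trace ℂ _ (Algebra.lmul ℂ (MonoidAlgebra ℂ G) (MonoidAlgebra.single g 1)) = 0 := by
  classical
  have := Fintype.ofFinite G
  rw [LinearMap.trace_eq_matrix_trace ℂ (MonoidAlgebra.basis G ℂ), Matrix.trace]
  refine Finset.sum_eq_zero fun i _ => ?_
  simp only [Matrix.diag, LinearMap.toMatrix_apply, MonoidAlgebra.basis_apply]
  simp [MonoidAlgebra.basis, MonoidAlgebra.single_mul_single, hg]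

section

variable {G : Type*} [Group G] {n : ℕ} {d : Fin n → ℕ}
  (e : MonoidAlgebra ℂ G ≃ₐ[ℂ] Π i, Matrix (Fin (d i)) (Fin (d i)) ℂ)

/-- The `i`-th matrix representation attached to a Wedderburn decomposition of `ℂ[G]`. -/
noncomputable def wedderburnRep (i : Fin n) : G →* Matrix (Fin (d i)) (Fin (d i)) ℂ :=
  ((Pi.evalMonoidHom _ i).comp e.toMonoidHom).comp (MonoidAlgebra.of ℂ G)

theorem wedderburnRep_apply (i : Fin n) (g : G) :
    wedderburnRep e i g = e (MonoidAlgebra.single g 1) i := rfl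

theorem apply_eq_sum_wedderburnRep (x : MonoidAlgebra ℂ G) (i : Fin n) :
    e x i = x.coeff.sum fun g c => c • wedderburnRep e i g := by
  induction x using MonoidAlgebra.induction_linear with
  | zero => simp
  | add f g hf hg =>
    rw [map_add, Pi.add_apply, hf, hg, MonoidAlgebra.coeff_add, Finsupp.sum_add_index'] <;>
      simp [add_smul]
  | single g c =>
    have : MonoidAlgebra.single g c = c • MonoidAlgebra.single g (1 : ℂ) := by simp
    rw [this, map_smul, Pi.smul_apply, ← wedderburnRep_apply]
    simp

theorem sum_mul_trace_wedderburnRep [Finite G] {g : G} (hg : g ≠ 1) :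
    ∑ i, (d i : ℂ) * (wedderburnRep e i g).trace = 0 := by
  have h := trace_lmul_pi_matrix (e (MonoidAlgebra.single g 1))
  simp only [wedderburnRep_apply]
  rw [← h, ← trace_lmul_single hg,
    ← LinearMap.trace_conj' (Algebra.lmul ℂ (MonoidAlgebra ℂ G) (MonoidAlgebra.single g 1))
      e.toLinearEquiv]
  congr 1
  refine LinearMap.ext fun x => ?_
  simp [LinearEquiv.conj_apply]

theorem wedderburnRep_surj (i : Fin n) (M : Matrix (Fin (d i)) (Fin (d i)) ℂ) :
    ∃ x, e x i = M :=
  ⟨e.symm (Pi.single i M), by simp⟩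

theorem wedderburnRep_pow_card [Finite G] (i : Fin n) (g : G) :
    wedderburnRep e i g ^ Nat.card G = 1 := by
  rw [← map_pow, pow_card_eq_one', map_one]

theorem isIntegral_trace_wedderburnRep [Finite G] (i : Fin n) (g : G) :
    IsIntegral ℤ (wedderburnRep e i g).trace := by
  rw [Matrix.trace_eq_sum_roots_charpoly]
  refine IsIntegral.multiset_sum fun x hx => ?_
  have := roots_pow_eq_one (wedderburnRep_pow_card e i g) hx
  exact ⟨Polynomial.X ^ Nat.card G - 1,
    Polynomial.monic_X_pow_sub_C 1 Nat.card_pos.ne', by simp [this]⟩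

theorem commute_wedderburnRep_of_commute {i : Fin n} {M : Matrix (Fin (d i)) (Fin (d i)) ℂ}
    (h : ∀ g, Commute M (wedderburnRep e i g)) : ∃ c : ℂ, M = c • 1 := by
  have hM : M ∈ Set.center (Matrix (Fin (d i)) (Fin (d i)) ℂ) := by
    rw [Semigroup.mem_center_iff]
    intro N
    obtain ⟨x, rfl⟩ := wedderburnRep_surj e i N
    rw [apply_eq_sum_wedderburnRep]
    refine (Commute.sum_right _ _ _ fun g _ => ((h g).smul_right _)).symm
  rw [Matrix.center_eq_range] at hM
  obtain ⟨c, rfl⟩ := hM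
  exact ⟨c, by ext; simp [Matrix.scalar_apply, Matrix.smul_apply, Matrix.diagonal_apply,
    Matrix.one_apply]⟩

theorem exists_isIntegral_card_conj_mul_trace [Finite G] [∀ i, NeZero (d i)]
    (i : Fin n) (g : G) :
    ∃ ω : ℂ, IsIntegral ℤ ω ∧
      (Nat.card (conjugatesOf g) : ℂ) * (wedderburnRep e i g).trace = d i * ω := by
  classical
  have := Fintype.ofFinite G
  set C : Finset G := (conjugatesOf g).toFinset with hC
  have hmem : ∀ x, x ∈ C ↔ IsConj g x := fun x => by
    rw [hC, Set.mem_toFinset]; rfl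
  obtain ⟨ω, hω⟩ := commute_wedderburnRep_of_commute e (i := i)
    (M := ∑ h ∈ C, wedderburnRep e i h) (fun k => by
      rw [Commute, SemiconjBy, Finset.sum_mul, Finset.mul_sum]
      refine Finset.sum_bij' (fun h _ => k⁻¹ * h * k) (fun h _ => k * h * k⁻¹) ?_ ?_ ?_ ?_ ?_
      · intro a ha
        rw [hmem] at ha ⊢
        exact ha.trans (isConj_iff.2 ⟨k⁻¹, by group⟩)
      · intro a ha
        rw [hmem] at ha ⊢
        exact ha.trans (isConj_iff.2 ⟨k, rfl⟩)
      · intro a _; group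
      · intro a _; group
      · intro a _
        rw [← map_mul, ← map_mul]; congr 1; group)
  have htr : ∀ h ∈ C, (wedderburnRep e i h).trace = (wedderburnRep e i g).trace := by
    intro h hh
    rw [hmem, isConj_iff] at hh
    obtain ⟨c, rfl⟩ := hh
    rw [map_mul, Matrix.trace_mul_comm, ← map_mul]
    congr 2; group
  have hcard : Nat.card (conjugatesOf g) = C.card := by
    rw [hC, Set.toFinset_card, Nat.card_eq_fintype_card]
  refine ⟨ω, ?_, ?_⟩
  · have hz : IsIntegral ℤ (∑ h ∈ C, MonoidAlgebra.single h (1 : ℤ)) :=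
      Algebra.IsIntegral.isIntegral _
    let f : MonoidAlgebra ℤ G →ₐ[ℤ] Matrix (Fin (d i)) (Fin (d i)) ℂ :=
      MonoidAlgebra.lift ℤ _ G (wedderburnRep e i)
    have := hz.map f
    simp only [map_sum, f, MonoidAlgebra.lift_single, one_smul, hω] at this
    rw [← Algebra.algebraMap_eq_smul_one] at this
    exact (isIntegral_algebraMap_iff (FaithfulSMul.algebraMap_injective ℂ _)).1 this
  · have := congrArg Matrix.trace hω
    rw [Matrix.trace_sum, Finset.sum_congr rfl htr] at this
    rw [Finset.sum_const, nsmul_eq_mul, Matrix.trace_smul, Matrix.trace_one, Fintype.card_fin,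
      smul_eq_mul, mul_comm ω] at this
    rw [hcard, this]

theorem apply_eq_smul_one_of_wedderburnRep_eq_one {i : Fin n} (hi : ∀ g, wedderburnRep e i g = 1)
    (x : MonoidAlgebra ℂ G) : e x i = (x.coeff.sum fun _ c => c) • 1 := by
  rw [apply_eq_sum_wedderburnRep]
  simp only [hi]
  rw [Finsupp.sum, Finsupp.sum, Finset.sum_smul]

theorem degree_eq_one_of_wedderburnRep_eq_one [∀ i, NeZero (d i)] {i : Fin n}
    (hi : ∀ g, wedderburnRep e i g = 1) : d i = 1 := by
  by_contra hne
  have h2 : 1 < d i := by have := NeZero.ne (d i); omega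
  obtain ⟨x, hx⟩ := wedderburnRep_surj e i (Matrix.single ⟨0, by omega⟩ ⟨1, h2⟩ 1)
  rw [apply_eq_smul_one_of_wedderburnRep_eq_one e hi] at hx
  have := congrFun (congrFun hx ⟨0, by omega⟩) ⟨1, h2⟩
  simp at this

theorem eq_of_wedderburnRep_eq_one [∀ i, NeZero (d i)] {i j : Fin n}
    (hi : ∀ g, wedderburnRep e i g = 1) (hj : ∀ g, wedderburnRep e j g = 1) : i = j := by
  by_contra hne
  have h1 := apply_eq_smul_one_of_wedderburnRep_eq_one e hi (e.symm (Pi.single i 1))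
  have h2 := apply_eq_smul_one_of_wedderburnRep_eq_one e hj (e.symm (Pi.single i 1))
  rw [e.apply_symm_apply] at h1 h2
  rw [Pi.single_eq_of_ne (Ne.symm hne)] at h2
  have h3 := (smul_eq_zero.1 h2.symm).resolve_right one_ne_zero
  rw [h3, zero_smul, Pi.single_eq_same] at h1
  exact one_ne_zero h1

theorem exists_wedderburnRep_eq_one [Finite G] : ∃ i, ∀ g, wedderburnRep e i g = 1 := by
  classical
  have := Fintype.ofFinite G
  set u : MonoidAlgebra ℂ G := ∑ h, MonoidAlgebra.single h 1 with hu
  have hmul : ∀ g, MonoidAlgebra.single g 1 * u = u := fun g => by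
    rw [hu, Finset.mul_sum]
    simp only [MonoidAlgebra.single_mul_single, mul_one]
    exact Fintype.sum_equiv (Equiv.mulLeft g) _ _ fun x => rfl
  have hmul' : ∀ g, u * MonoidAlgebra.single g 1 = u := fun g => by
    rw [hu, Finset.sum_mul]
    simp only [MonoidAlgebra.single_mul_single, mul_one]
    exact Fintype.sum_equiv (Equiv.mulRight g) _ _ fun x => rfl
  have hu0 : u ≠ 0 := by
    intro h0
    have := congrArg (fun x => MonoidAlgebra.coeff x 1) h0
    simp [hu, Finsupp.single_apply, MonoidAlgebra.coeff_sum] at this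
  have : ∃ i, e u i ≠ 0 := by
    by_contra! hall
    exact hu0 (e.injective (by rw [map_zero]; exact funext hall))
  obtain ⟨i, hi⟩ := this
  refine ⟨i, fun g => ?_⟩
  have hl : ∀ g, wedderburnRep e i g * e u i = e u i := fun g => by
    rw [wedderburnRep_apply, ← Pi.mul_apply, ← map_mul, hmul]
  have hr : ∀ g, e u i * wedderburnRep e i g = e u i := fun g => by
    rw [wedderburnRep_apply, ← Pi.mul_apply, ← map_mul, hmul']
  obtain ⟨c, hc⟩ := commute_wedderburnRep_of_commute e (i := i) (M := e u i) fun g =>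
    (hr g).trans (hl g).symm
  have hc0 : c ≠ 0 := fun h => hi (by rw [hc, h, zero_smul])
  have := hl g
  rw [hc, mul_smul_comm, mul_one] at this
  exact smul_right_injective _ hc0 this

theorem wedderburnRep_trichotomy [∀ i, NeZero (d i)] [Finite G] [IsSimpleGroup G]
    (hnc : ¬ ∀ a b : G, a * b = b * a) {g : G} (hg : g ≠ 1) {p k : ℕ} (hp : p.Prime)
    (hk : Nat.card (conjugatesOf g) = p ^ k) (i : Fin n) :
    (∀ h, wedderburnRep e i h = 1) ∨ p ∣ d i ∨ (wedderburnRep e i g).trace = 0 := by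
  by_cases hpd : p ∣ d i
  · exact Or.inr (Or.inl hpd)
  obtain ⟨ω, hω, hω'⟩ := exists_isIntegral_card_conj_mul_trace e i g
  have hd : (d i : ℂ) ≠ 0 := by exact_mod_cast NeZero.ne (d i)
  have hcop : IsCoprime ((p ^ k : ℕ) : ℤ) (d i : ℤ) :=
    Nat.isCoprime_iff_coprime.2 (((Nat.Prime.coprime_iff_not_dvd hp).2 hpd).pow_left k)
  obtain ⟨a, b, hab⟩ := hcop
  have htr := isIntegral_trace_wedderburnRep e i g
  have h_int : IsIntegral ℤ ((wedderburnRep e i g).trace / d i) := by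
    have : (wedderburnRep e i g).trace / d i = a * ω + b * (wedderburnRep e i g).trace := by
      rw [div_eq_iff hd]
      have hab' : (a : ℂ) * ((p ^ k : ℕ) : ℂ) + b * d i = 1 := by exact_mod_cast hab
      rw [hk] at hω'
      linear_combination (-(wedderburnRep e i g).trace) * hab' + (a : ℂ) * hω'
    rw [this]
    exact ((isIntegral_algebraMap (x := a)).mul hω).add ((isIntegral_algebraMap (x := b)).mul htr)
  rw [Matrix.trace_eq_sum_roots_charpoly] at h_int ⊢
  have hcard : (wedderburnRep e i g).charpoly.roots.card = d i := by
    rw [← (IsAlgClosed.splits (wedderburnRep e i g).charpoly).natDegree_eq_card_roots,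
      Matrix.charpoly_natDegree_eq_dim, Fintype.card_fin]
  replace hcard : (d i : ℂ) = (wedderburnRep e i g).charpoly.roots.card := by rw [hcard]
  rw [hcard] at h_int
  rcases sum_eq_zero_or_eq_of_isIntegral_average Nat.card_pos.ne'
    (fun x hx => roots_pow_eq_one (wedderburnRep_pow_card e i g) hx) h_int with h | ⟨z, hz⟩
  · exact Or.inr (Or.inr h)
  left
  obtain ⟨c, hc⟩ := exists_eq_smul_one_of_pow_eq_one Nat.card_pos.ne'
    (wedderburnRep_pow_card e i g) hz
  rcases (inferInstance : (wedderburnRep e i).ker.Normal).eq_bot_or_eq_top with hbot | htop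
  · exfalso
    have hcomm : ∀ h, g * h = h * g := fun h => by
      refine (MonoidHom.ker_eq_bot_iff _).1 hbot ?_
      rw [map_mul, map_mul, hc]; simp
    have hgc : g ∈ Subgroup.center G := Subgroup.mem_center_iff.2 fun h => (hcomm h).symm
    rcases (inferInstance : (Subgroup.center G).Normal).eq_bot_or_eq_top with h1 | h1
    · rw [h1, Subgroup.mem_bot] at hgc; exact hg hgc
    · refine hnc fun a b => ?_
      have : b ∈ Subgroup.center G := h1 ▸ Subgroup.mem_top b
      exact Subgroup.mem_center_iff.1 this a
  · intro h
    exact (MonoidHom.mem_ker).1 (htop ▸ Subgroup.mem_top h)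

end

theorem IsSimpleGroup.mul_comm_of_card_conjugatesOf_eq_prime_pow {G : Type*} [Group G] [Finite G]
    [IsSimpleGroup G] {g : G} (hg : g ≠ 1) {p k : ℕ} (hp : p.Prime)
    (hk : Nat.card (conjugatesOf g) = p ^ k) (a b : G) : a * b = b * a := by
  by_contra hab
  have hnc : ¬ ∀ a b : G, a * b = b * a := fun h => hab (h a b)
  have : NeZero (Nat.card G : ℂ) := ⟨by exact_mod_cast Nat.card_pos.ne'⟩
  obtain ⟨n, d, hd, ⟨e⟩⟩ :=
    IsSemisimpleRing.exists_algEquiv_pi_matrix_of_isAlgClosed ℂ (MonoidAlgebra ℂ G)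
  obtain ⟨i, hi⟩ := exists_wedderburnRep_eq_one e
  have hsum := sum_mul_trace_wedderburnRep e hg
  rw [← Finset.add_sum_erase _ _ (Finset.mem_univ i), hi g, Matrix.trace_one, Fintype.card_fin,
    degree_eq_one_of_wedderburnRep_eq_one e hi] at hsum
  have hdvd : ∀ j ∈ Finset.univ.erase i, ∃ β : ℂ, IsIntegral ℤ β ∧
      (d j : ℂ) * (wedderburnRep e j g).trace = p * β := by
    intro j hj
    rcases wedderburnRep_trichotomy e hnc hg hp hk j with h | ⟨c, h⟩ | h
    · exact absurd (eq_of_wedderburnRep_eq_one e h hi) (Finset.ne_of_mem_erase hj)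
    · exact ⟨c * (wedderburnRep e j g).trace,
        (isIntegral_algebraMap (R := ℤ) (x := (c : ℤ))).mul (isIntegral_trace_wedderburnRep e j g),
        by
          have h' : (d j : ℂ) = p * c := by exact_mod_cast h
          rw [h']; ring⟩
    · exact ⟨0, isIntegral_zero, by rw [h]; simp⟩
  choose! β hβ hβ' using hdvd
  rw [Finset.sum_congr rfl hβ', ← Finset.mul_sum] at hsum
  have hB := IsIntegral.sum _ hβ
  set B := ∑ j ∈ Finset.univ.erase i, β j
  have hp0 : (p : ℂ) ≠ 0 := by exact_mod_cast hp.ne_zero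
  have hBq : B = algebraMap ℚ ℂ (-1 / p) := by
    simp only [map_div₀, map_neg, map_one, map_natCast]
    field_simp
    linear_combination hsum
  rw [hBq, isIntegral_algebraMap_iff (algebraMap ℚ ℂ).injective,
    IsIntegrallyClosed.isIntegral_iff] at hB
  obtain ⟨y, hy⟩ := hB
  have hp0' : (p : ℚ) ≠ 0 := by exact_mod_cast hp.ne_zero
  have : (y : ℚ) * p = -1 := by
    rw [show (y : ℚ) = -1 / p from hy]; field_simp
  have h3 : y * p = -1 := by exact_mod_cast this
  have h4 : (p : ℤ) ∣ 1 := ⟨-y, by linarith⟩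
  exact hp.one_lt.ne' (by exact_mod_cast Int.natAbs_dvd_natAbs.2 h4 |> Nat.dvd_one.1)

theorem Subgroup.index_inf_of_coprime {G : Type*} [Group G] [Finite G] {H K : Subgroup G}
    (h : H.index.Coprime K.index) : (H ⊓ K).index = H.index * K.index :=
  le_antisymm Subgroup.index_inf_le <| Nat.le_of_dvd
    (Nat.pos_of_ne_zero Subgroup.index_ne_zero_of_finite)
    (h.mul_dvd_of_dvd_of_dvd (Subgroup.index_dvd_of_le inf_le_left)
      (Subgroup.index_dvd_of_le inf_le_right))

theorem Subgroup.relIndex_of_coprime {G : Type*} [Group G] [Finite G] {H K : Subgroup G}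
    (h : H.index.Coprime K.index) : K.relIndex H = K.index := by
  have h1 := Subgroup.index_inf_of_coprime h
  rw [← Subgroup.relIndex_mul_index (inf_le_left : H ⊓ K ≤ H), Subgroup.inf_relIndex_left,
    mul_comm] at h1
  exact Nat.eq_of_mul_eq_mul_left (Nat.pos_of_ne_zero Subgroup.index_ne_zero_of_finite) h1

theorem MulAction.exists_mem_smul_eq_of_coprime_index {G X : Type*} [Group G] [Finite G]
    [MulAction G X] [MulAction.IsPretransitive G X] {H : Subgroup G}
    (h : H.index.Coprime (Nat.card X)) (x y : X) : ∃ g ∈ H, g • x = y := by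
  rw [← MulAction.index_stabilizer_of_transitive G x] at h
  have h1 := Subgroup.relIndex_of_coprime h
  have : Finite X := Finite.of_surjective (fun g : G => g • x) (MulAction.surjective_smul G x)
  have h2 : (MulAction.orbit H x).ncard = Nat.card X := by
    rw [← MulAction.index_stabilizer_of_transitive G x, ← h1, ← MulAction.index_stabilizer]
    rfl
  have h3 : MulAction.orbit H x = Set.univ := by
    rw [Set.eq_univ_iff_ncard, h2]
  obtain ⟨⟨g, hg⟩, hgy⟩ : y ∈ MulAction.orbit H x := h3 ▸ Set.mem_univ y
  exact ⟨g, hg, hgy⟩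

theorem Group.card_conjugatesOf {G : Type*} [Group G] (g : G) :
    Nat.card (conjugatesOf g) = (Subgroup.centralizer {g}).index := by
  have h1 : (MulAction.stabilizer (ConjAct G) g).index = Nat.card (conjugatesOf g) := by
    rw [MulAction.index_stabilizer, ConjAct.orbit_eq_carrier_conjClasses, Nat.card_coe_set_eq]
    rfl
  rw [← h1, Subgroup.centralizer_eq_comap_stabilizer]
  exact (Subgroup.index_comap_of_surjective _ ConjAct.toConjAct.surjective).symm

theorem Group.isSolvable_of_prime_dvd_card_eq_or_eq {p q : ℕ} {G : Type*} [Group G] [Finite G]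
    (h : ∀ s, s.Prime → s ∣ Nat.card G → s = p ∨ s = q) : Group.IsSolvable G := by
  induction hn : Nat.card G using Nat.strong_induction_on generalizing G with
  | _ n ih =>
  subst hn
  rcases subsingleton_or_nontrivial G with hG | hG
  · infer_instance
  by_cases hs : IsSimpleGroup G
  · obtain ⟨s, hsp, hs'⟩ := Nat.exists_prime_and_dvd (Finite.one_lt_card (α := G)).ne'
    obtain ⟨t, ht⟩ : ∃ t, ∀ u, u.Prime → u ∣ Nat.card G → u ≠ s → u = t := by
      rcases h s hsp hs' with rfl | rfl
      · exact ⟨q, fun u hu hu' hne => (h u hu hu').resolve_left hne⟩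
      · exact ⟨p, fun u hu hu' hne => (h u hu hu').resolve_right hne⟩
    have := Fact.mk hsp
    obtain ⟨Q⟩ : Nonempty (Sylow s G) := inferInstance
    have hQn : Nontrivial Q := by
      rw [← Finite.one_lt_card_iff_nontrivial]
      exact hsp.one_lt.trans_le (Nat.le_of_dvd Nat.card_pos (Q.dvd_card_of_dvd_card hs'))
    have := Q.2.center_nontrivial
    obtain ⟨⟨⟨z, hzQ⟩, hzc⟩, hz1⟩ := exists_ne (1 : Subgroup.center Q)
    have hz : z ≠ 1 := fun h0 => hz1 (by ext; exact h0)
    have hle : (Q : Subgroup G) ≤ Subgroup.centralizer {z} := fun x hx => by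
      rw [Subgroup.mem_centralizer_singleton_iff]
      exact congrArg Subtype.val (Subgroup.mem_center_iff.1 hzc ⟨x, hx⟩)
    have hndvd : ¬ s ∣ (Subgroup.centralizer {z}).index := fun hd =>
      Q.not_dvd_index (hd.trans (Subgroup.index_dvd_of_le hle))
    refine IsSimpleGroup.comm_iff_isSolvable.1 fun a b => ?_
    have hpow := Nat.eq_prime_pow_of_unique_prime_dvd (p := t)
      (Subgroup.index_ne_zero_of_finite (H := Subgroup.centralizer {z})) fun {u} hu hud =>
        ht u hu (hud.trans (Subgroup.index_dvd_card _)) fun h0 => hndvd (h0 ▸ hud)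
    by_cases htp : t.Prime
    · exact IsSimpleGroup.mul_comm_of_card_conjugatesOf_eq_prime_pow hz htp
        ((Group.card_conjugatesOf z).trans hpow) a b
    · refine IsSimpleGroup.mul_comm_of_card_conjugatesOf_eq_prime_pow hz hsp (k := 0)
        ((Group.card_conjugatesOf z).trans ?_) a b
      by_contra hne
      obtain ⟨u, hu, hud⟩ := Nat.exists_prime_and_dvd hne
      exact htp (ht u hu (hud.trans (Subgroup.index_dvd_card _)) (fun h0 => hndvd (h0 ▸ hud)) ▸ hu)
  · obtain ⟨N, hN, hb, ht⟩ : ∃ N : Subgroup G, N.Normal ∧ N ≠ ⊥ ∧ N ≠ ⊤ := by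
      by_contra! hall
      exact hs ⟨fun N hN => or_iff_not_imp_left.2 (hall N hN)⟩
    have h1 := Subgroup.one_lt_card_iff_ne_bot N |>.2 hb
    have h2 := Subgroup.one_lt_index_of_ne_top ht
    have h3 := N.card_mul_index
    rw [Group.isSolvable_iff_subgroup_quotient N]
    refine ⟨ih _ ?_ (fun s hs hd => h s hs (hd.trans N.card_subgroup_dvd_card)) rfl,
      ih _ ?_ (fun s hs hd => h s hs (hd.trans N.card_quotient_dvd_card)) rfl⟩
    · nlinarith
    · rw [← Subgroup.index_eq_card]; nlinarith

theorem Subgroup.le_of_normal_isPGroup {G : Type*} [Group G] [Finite G] {s : ℕ} (hs : s.Prime)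
    {M L : Subgroup G} [M.Normal] (hM : IsPGroup s M) (hL : ¬ s ∣ L.index) : M ≤ L := by
  have := Fact.mk hs
  rw [Subgroup.index_eq_card] at hL
  obtain ⟨x, hx⟩ := hM.nonempty_fixed_point_of_prime_not_dvd_card (G ⧸ L) hL
  induction x using QuotientGroup.induction_on with
  | H g =>
  intro m hm
  have h1 := hx ⟨g * m * g⁻¹, Subgroup.Normal.conj_mem inferInstance m hm g⟩
  have h2 : ((g * m * g⁻¹ * g : G) : G ⧸ L) = g := h1
  rw [eq_comm, QuotientGroup.eq] at h2
  simpa [mul_assoc] using h2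

theorem Group.IsSolvable.exists_normal_isPGroup {G : Type*} [Group G] [Finite G] [Nontrivial G]
    [hG : Group.IsSolvable G] :
    ∃ (s : ℕ) (M : Subgroup G), s.Prime ∧ M.Normal ∧ M ≠ ⊥ ∧ IsPGroup s M := by
  obtain ⟨n, hn⟩ := hG.solvable
  obtain ⟨k, hk, hk1⟩ : ∃ k, derivedSeries G k ≠ ⊥ ∧ derivedSeries G (k + 1) = ⊥ := by
    classical
    have hex : ∃ n, derivedSeries G n = ⊥ := ⟨n, hn⟩
    have h0 : Nat.find hex ≠ 0 := fun h0 => by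
      have := Nat.find_spec hex
      rw [h0, derivedSeries_zero] at this
      exact top_ne_bot this
    refine ⟨Nat.find hex - 1, Nat.find_min hex (by omega), ?_⟩
    rw [Nat.sub_add_cancel (by omega)]
    exact Nat.find_spec hex
  set A := derivedSeries G k with hA
  have hcomm : ∀ a b : A, a * b = b * a := fun a b => by
    rw [derivedSeries_succ] at hk1
    exact Subtype.ext ((Subgroup.commutator_eq_bot_iff_le_centralizer.1 hk1 b.2 a a.2))
  obtain ⟨s, hs, hsd⟩ := Nat.exists_prime_and_dvd ((Subgroup.one_lt_card_iff_ne_bot A).2 hk).ne'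
  have := Fact.mk hs
  obtain ⟨Q⟩ : Nonempty (Sylow s A) := inferInstance
  have hQ : (Q : Subgroup A).Normal := ⟨fun n hn g => by rwa [hcomm g n, mul_inv_cancel_right]⟩
  have := Q.characteristic_of_normal hQ
  refine ⟨s, (Q : Subgroup A).map A.subtype, hs, inferInstance, ?_, Q.2.map _⟩
  rw [Ne, Subgroup.map_eq_bot_iff_of_injective _ A.subtype_injective, ← Ne,
    ← Subgroup.one_lt_card_iff_ne_bot]
  exact hs.one_lt.trans_le (Nat.le_of_dvd Nat.card_pos (Q.dvd_card_of_dvd_card hsd))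

theorem Group.isSolvable_of_exists_complement {G : Type*} [Group G] [Finite G]
    (h : ∀ p : ℕ, p.Prime → ∃ H : Subgroup G, (Nat.card H).Coprime p ∧ ∃ k, H.index = p ^ k) :
    Group.IsSolvable G := by
  induction hn : Nat.card G using Nat.strong_induction_on generalizing G with
  | _ n ih =>
  subst hn
  have hsub : ∀ p, p.Prime → p ∣ Nat.card G → ∀ H : Subgroup G, (Nat.card H).Coprime p →
      (∃ k, H.index = p ^ k) → Group.IsSolvable H := by
    intro p hp hpd H hH ⟨k, hk⟩
    refine ih _ (lt_of_le_of_ne (Nat.le_of_dvd Nat.card_pos H.card_subgroup_dvd_card) fun h0 => ?_)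
      (fun q hq => ?_) rfl
    · rw [h0] at hH
      exact hp.one_lt.ne' (Nat.Coprime.eq_one_of_dvd hH.symm hpd)
    · by_cases hqp : q = p
      · subst hqp
        exact ⟨⊤, by simpa using hH, 0, by simp⟩
      · obtain ⟨K, hK, l, hl⟩ := h q hq
        refine ⟨K.subgroupOf H, ?_, l, ?_⟩
        · refine Nat.Coprime.coprime_dvd_left ?_ hK
          rw [← Subgroup.card_map_of_injective H.subtype_injective (K := K.subgroupOf H)]
          refine Subgroup.card_dvd_of_le ?_
          rw [Subgroup.subgroupOf_map_subtype]; exact inf_le_left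
        · change K.relIndex H = _
          rw [Subgroup.relIndex_of_coprime, hl]
          rw [hk, hl]
          exact Nat.Coprime.pow _ _ ((Nat.coprime_primes hp hq).2 (Ne.symm hqp))
  by_cases h1 : Nat.card G = 1
  · exact Group.isSolvable_of_prime_dvd_card_eq_or_eq (p := 0) (q := 0) fun s hs hd =>
      absurd (Nat.dvd_one.1 (h1 ▸ hd)) hs.one_lt.ne'
  obtain ⟨p, hp, hpd⟩ := Nat.exists_prime_and_dvd h1
  obtain ⟨H, hH, k, hk⟩ := h p hp
  have hHs := hsub p hp hpd H hH ⟨k, hk⟩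
  rcases subsingleton_or_nontrivial H with hHt | hHt
  · refine Group.isSolvable_of_prime_dvd_card_eq_or_eq (p := p) (q := p) fun s hs hd => ?_
    rw [← H.card_mul_index, Nat.card_of_subsingleton (1 : H), one_mul, hk] at hd
    exact Or.inl ((Nat.prime_dvd_prime_iff_eq hs hp).1 (hs.dvd_of_dvd_pow hd))
  obtain ⟨s, M, hs, hMn, hMb, hM⟩ := Group.IsSolvable.exists_normal_isPGroup (G := H)
  by_cases hq : ∃ q, q.Prime ∧ q ∣ Nat.card G ∧ q ≠ p ∧ q ≠ s
  swap
  · push Not at hq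
    exact Group.isSolvable_of_prime_dvd_card_eq_or_eq (p := p) (q := s) fun q hqp hqd =>
      or_iff_not_imp_left.2 (hq q hqp hqd)
  obtain ⟨q, hq, hqd, hqp, hqs⟩ := hq
  obtain ⟨K, hK, l, hl⟩ := h q hq
  have hKs := hsub q hq hqd K hK ⟨l, hl⟩
  have hcop : H.index.Coprime K.index := by
    rw [hk, hl]
    exact Nat.Coprime.pow _ _ ((Nat.coprime_primes hp hq).2 (Ne.symm hqp))
  have hMK : M ≤ K.subgroupOf H := by
    refine Subgroup.le_of_normal_isPGroup hs hM ?_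
    change ¬ s ∣ K.relIndex H
    rw [Subgroup.relIndex_of_coprime hcop, hl]
    exact fun hd => hqs ((Nat.prime_dvd_prime_iff_eq hs hq).1 (hs.dvd_of_dvd_pow hd)).symm
  set L := Subgroup.normalClosure (M.map H.subtype : Set G) with hL
  have hLK : L ≤ K := by
    rw [hL, Subgroup.normalClosure, Subgroup.closure_le]
    intro x hx
    rw [Group.mem_conjugatesOfSet_iff] at hx
    obtain ⟨_, ⟨m, hm, rfl⟩, hx⟩ := hx
    obtain ⟨g, rfl⟩ := isConj_iff.1 hx
    obtain ⟨b, hb, hbg⟩ := MulAction.exists_mem_smul_eq_of_coprime_index (X := G ⧸ H) (H := K)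
      (by rw [← Subgroup.index_eq_card]; exact hcop.symm) (1 : G) (g : G)
    have hbg' : ((b * 1 : G) : G ⧸ H) = g := hbg
    rw [QuotientGroup.eq, mul_one] at hbg'
    have := hMK (hMn.conj_mem m hm ⟨_, hbg'⟩)
    rw [Subgroup.mem_subgroupOf] at this
    have h3 := K.mul_mem (K.mul_mem hb this) (K.inv_mem hb)
    simpa [mul_assoc] using h3
  have hLb : L ≠ ⊥ := fun h0 => hMb <| by
    rw [← Subgroup.map_eq_bot_iff_of_injective _ H.subtype_injective, eq_bot_iff, ← h0]
    exact Subgroup.subset_normalClosure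
  rw [Group.isSolvable_iff_subgroup_quotient L]
  refine ⟨Group.isSolvable_of_isSolvable_injective (Subgroup.inclusion_injective hLK),
    ih _ ?_ (fun t ht => ?_) rfl⟩
  · have h2 := (Subgroup.one_lt_card_iff_ne_bot L).2 hLb
    have h3 := L.card_mul_index
    have h4 : 0 < L.index := Nat.pos_of_ne_zero Subgroup.index_ne_zero_of_finite
    rw [← Subgroup.index_eq_card]; nlinarith
  · obtain ⟨T, hT, m, hm⟩ := h t ht
    refine ⟨T.map (QuotientGroup.mk' L), hT.coprime_dvd_left (Subgroup.card_map_dvd _ _), ?_⟩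
    have := Subgroup.index_map_dvd T (QuotientGroup.mk'_surjective L)
    rw [hm, Nat.dvd_prime_pow ht] at this
    obtain ⟨m', -, hm'⟩ := this
    exact ⟨m', hm'⟩

theorem MulAction.exists_card_eq_mul_card_fiber {G X Z : Type*} [Group G] [MulAction G X]
    [MulAction.IsPretransitive G X] {f : X → Z} (hf : Function.Surjective f)
    (h : ∀ (g : G) (a b : X), f a = f b → f (g • a) = f (g • b)) (z : Z) :
    Nat.card X = Nat.card Z * Nat.card {x // f x = z} := by
  have key : ∀ w : Z, Nonempty ({x // f x = w} ≃ {x // f x = z}) := fun w => by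
    obtain ⟨a, rfl⟩ := hf w
    obtain ⟨b, rfl⟩ := hf z
    obtain ⟨g, rfl⟩ := MulAction.exists_smul_eq G a b
    refine ⟨(MulAction.toPerm g).subtypeEquiv fun x => ⟨fun hx => h g _ _ hx, fun hx => ?_⟩⟩
    simpa using h g⁻¹ _ _ hx
  rw [← Nat.card_prod]
  exact Nat.card_congr ((Equiv.sigmaFiberEquiv f).symm.trans
    (Equiv.sigmaEquivProdOfEquiv fun w => (key w).some))

namespace YBE

variable {X : Type u} {Z : Type v}

theorem σ_inv_apply_eq (S : YBE X) {y y' : X} (h : S.σ y = S.σ y') (x : X) :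
    S.σ ((S.σ x)⁻¹ y) = S.σ ((S.σ x)⁻¹ y') := by
  refine mul_left_cancel (a := S.σ x) ?_
  rw [S.ybe x y, S.ybe x y', h]

theorem σ_apply_eq_iff [Finite X] (S : YBE X) (x y y' : X) :
    S.σ y = S.σ y' ↔ S.σ (S.σ x y) = S.σ (S.σ x y') := by
  refine ⟨fun h => ?_, fun h => by simpa using S.σ_inv_apply_eq h x⟩
  have hpow : ∀ n : ℕ, S.σ (((S.σ x)⁻¹ ^ n) y) = S.σ (((S.σ x)⁻¹ ^ n) y') := by
    intro n
    induction n with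
    | zero => simpa using h
    | succ n ih =>
      rw [pow_succ', Perm.mul_apply, Perm.mul_apply]
      exact S.σ_inv_apply_eq ih x
  obtain ⟨n, hn⟩ := (mem_powers_iff_mem_zpowers (x := (S.σ x)⁻¹) (y := S.σ x)).2
    (by rw [Subgroup.zpowers_inv]; exact Subgroup.mem_zpowers _)
  have := hpow n
  rwa [show (S.σ x)⁻¹ ^ n = S.σ x from hn] at this

/-- The solution induced on the quotient of `X` by the retract relation. -/
def retract [Finite X] (S : YBE X) : YBE (Quotient (Setoid.ker S.σ)) where
  σ := Quotient.lift (fun x => Quotient.congr (S.σ x) fun y y' => S.σ_apply_eq_iff x y y')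
    fun x x' (h : S.σ x = S.σ x') => by
      ext q
      induction q using Quotient.inductionOn with
      | h y => simp only [Quotient.congr_mk, h]
  ybe a b := by
    induction a using Quotient.inductionOn with | h x =>
    induction b using Quotient.inductionOn with | h y =>
    ext q
    induction q using Quotient.inductionOn with | h z =>
    exact congrArg (Quotient.mk _) (DFunLike.congr_fun (S.ybe x y) z)

theorem isRetract_retract [Finite X] (S : YBE X) : S.IsRetract S.retract :=
  ⟨Quotient.mk _, Quotient.mk_surjective, fun _ _ => rfl, fun _ _ => Quotient.eq⟩

theorem IsHom.exists_mem_permGroup {S : YBE X} {T : YBE Z} {f : X → Z} (hf : S.IsHom T f)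
    {g : Perm X} (hg : g ∈ S.permGroup) : ∃ g' ∈ T.permGroup, ∀ x, f (g x) = g' (f x) := by
  induction hg using Subgroup.closure_induction with
  | mem g hg =>
    obtain ⟨x, rfl⟩ := hg
    exact ⟨T.σ (f x), Subgroup.subset_closure ⟨_, rfl⟩, hf x⟩
  | one => exact ⟨1, one_mem _, fun _ => rfl⟩
  | mul a b _ _ ha hb =>
    obtain ⟨a', ha', ha⟩ := ha
    obtain ⟨b', hb', hb⟩ := hb
    exact ⟨a' * b', mul_mem ha' hb', fun x => by simp [ha, hb]⟩
  | inv a _ ha =>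
    obtain ⟨a', ha', ha⟩ := ha
    exact ⟨a'⁻¹, inv_mem ha', fun x => by rw [Perm.eq_inv_iff_eq, ← ha]; simp⟩

theorem IsHom.indecomposable {S : YBE X} {T : YBE Z} {f : X → Z} (hf : S.IsHom T f)
    (hs : Function.Surjective f) (hS : S.Indecomposable) : T.Indecomposable := by
  intro a b
  obtain ⟨x, rfl⟩ := hs a
  obtain ⟨y, rfl⟩ := hs b
  obtain ⟨g, hg, rfl⟩ := hS x y
  obtain ⟨g', hg', h⟩ := hf.exists_mem_permGroup hg
  exact ⟨g', hg', (h x).symm⟩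

theorem Indecomposable.isPretransitive {S : YBE X} (hS : S.Indecomposable) :
    MulAction.IsPretransitive S.permGroup X :=
  ⟨fun x y => let ⟨g, hg, h⟩ := hS x y; ⟨⟨g, hg⟩, h⟩⟩

theorem IsHom.card_dvd {S : YBE X} {T : YBE Z} {f : X → Z} (hf : S.IsHom T f)
    (hs : Function.Surjective f) (hS : S.Indecomposable) : Nat.card Z ∣ Nat.card X := by
  have := hS.isPretransitive
  rcases isEmpty_or_nonempty Z with hZ | ⟨⟨z⟩⟩
  · have := Function.isEmpty f
    simp
  · rw [MulAction.exists_card_eq_mul_card_fiber (G := S.permGroup) hs (fun g a b hab => ?_) z]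
    · exact dvd_mul_right _ _
    · obtain ⟨g', -, h⟩ := hf.exists_mem_permGroup g.2
      exact (h a).trans ((congrArg g' hab).trans (h b).symm)

theorem card_retract_lt [Finite X] {S : YBE X} (h : ¬ Function.Injective S.σ) :
    Nat.card (Quotient (Setoid.ker S.σ)) < Nat.card X := by
  refine lt_of_le_of_ne (Nat.card_le_card_of_surjective _ Quotient.mk_surjective) fun h0 => h ?_
  have := (Nat.bijective_iff_surjective_and_card (Quotient.mk (Setoid.ker S.σ))).2
    ⟨Quotient.mk_surjective, h0.symm⟩
  exact fun x y hxy => this.1 (Quotient.sound hxy)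

theorem closed_eq_univ {N : ℕ}
    (hN : ∀ (X : Type u) (S : YBE X), Finite X → S.Indecomposable → Squarefree (Nat.card X) →
      1 < Nat.card X → Nat.card X < N → ¬ Function.Injective S.σ)
    {X : Type u} [Finite X] {S : YBE X} (hS : S.Indecomposable) (hsq : Squarefree (Nat.card X))
    (hX : Nat.card X < N) {Y : Set X} (hY : Y.Nonempty)
    (hclosed : ∀ x ∈ Y, ∀ y ∈ Y, S.σ x y ∈ Y) : Y = Set.univ := by
  induction hn : Nat.card X using Nat.strong_induction_on generalizing X with
  | _ n ih =>
  subst hn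
  obtain ⟨y₀, hy₀⟩ := hY
  rcases le_or_gt (Nat.card X) 1 with h1 | h1
  · have := (Finite.card_le_one_iff_subsingleton).1 h1
    exact Set.eq_univ_of_forall fun x => Subsingleton.elim y₀ x ▸ hy₀
  have hlt := card_retract_lt (hN X S inferInstance hS hsq h1 hX)
  have hs : Function.Surjective (Quotient.mk (Setoid.ker S.σ)) := Quotient.mk_surjective
  have hh : S.IsHom S.retract (Quotient.mk _) := fun _ _ => rfl
  have himage := ih _ hlt (hh.indecomposable hs hS)
    (hsq.squarefree_of_dvd (hh.card_dvd hs hS)) (hlt.trans hX)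
    (Y := Quotient.mk (Setoid.ker S.σ) '' Y) ⟨_, y₀, hy₀, rfl⟩ (by
      rintro _ ⟨x, hx, rfl⟩ _ ⟨y, hy, rfl⟩
      exact ⟨_, hclosed x hx y hy, rfl⟩) rfl
  have hσ : ∀ x, ∀ y ∈ Y, S.σ x y ∈ Y := by
    intro x y hy
    obtain ⟨x', hx', h⟩ : Quotient.mk (Setoid.ker S.σ) x ∈ Quotient.mk (Setoid.ker S.σ) '' Y :=
      himage ▸ Set.mem_univ _
    rw [← show S.σ x' = S.σ x from Quotient.exact h]
    exact hclosed x' hx' y hy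
  have hG : ∀ g ∈ S.permGroup, ∀ y, y ∈ Y ↔ g y ∈ Y := by
    intro g hg
    induction hg using Subgroup.closure_induction with
    | mem g hg =>
      obtain ⟨x, rfl⟩ := hg
      intro y
      refine ⟨hσ x y, fun hy => ?_⟩
      have hbij := (Y.toFinite.injOn_iff_bijOn_of_mapsTo (hσ x)).1 (S.σ x).injective.injOn
      obtain ⟨y', hy', h⟩ := hbij.surjOn hy
      exact (S.σ x).injective h ▸ hy'
    | one => simp
    | mul a b _ _ ha hb => intro y; rw [hb, ha]; rfl
    | inv a _ ha => intro y; rw [ha (a⁻¹ y)]; simp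
  refine Set.eq_univ_of_forall fun x => ?_
  obtain ⟨g, hg, rfl⟩ := hS y₀ x
  exact (hG g hg y₀).1 hy₀

/-- If every indecomposable solution of square-free cardinality greater than one has a proper
retract, then every such solution is a multipermutation solution. -/
theorem exists_mpLevelLE
    (hN : ∀ (X : Type u) (S : YBE X), Finite X → S.Indecomposable → Squarefree (Nat.card X) →
      1 < Nat.card X → ¬ Function.Injective S.σ)
    {X : Type u} [Finite X] [Nonempty X] {S : YBE X} (hS : S.Indecomposable)
    (hsq : Squarefree (Nat.card X)) : ∃ n, MPLevelLE n X S := by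
  induction hn : Nat.card X using Nat.strong_induction_on generalizing X with
  | _ n ih =>
  subst hn
  rcases le_or_gt (Nat.card X) 1 with h1 | h1
  · exact ⟨0, inferInstance, (Finite.card_le_one_iff_subsingleton).1 h1⟩
  have hlt := card_retract_lt (hN X S inferInstance hS hsq h1)
  have hs : Function.Surjective (Quotient.mk (Setoid.ker S.σ)) := Quotient.mk_surjective
  have hh : S.IsHom S.retract (Quotient.mk _) := fun _ _ => rfl
  have : Nonempty (Quotient (Setoid.ker S.σ)) := Nonempty.map (Quotient.mk _) inferInstance
  obtain ⟨m, hm⟩ := ih _ hlt (hh.indecomposable hs hS)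
    (hsq.squarefree_of_dvd (hh.card_dvd hs hS)) rfl
  exact ⟨m + 1, _, S.retract, S.isRetract_retract, hm⟩

theorem MPLevelLE.succ [Finite X] {S : YBE X} {n : ℕ} (h : MPLevelLE n X S) :
    MPLevelLE (n + 1) X S := by
  induction n generalizing X with
  | zero =>
    obtain ⟨h1, h2⟩ := h
    have : Nonempty (Quotient (Setoid.ker S.σ)) := h1.map (Quotient.mk _)
    exact ⟨_, S.retract, S.isRetract_retract, inferInstance, inferInstance⟩
  | succ n ih =>
    obtain ⟨Z, T, hT, h⟩ := h
    have : Finite Z := Finite.of_surjective _ hT.choose_spec.1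
    exact ⟨Z, T, hT, ih h⟩

/-- Left addition of `σ x` in the brace `𝒢(X,r)`, as a map on the group. -/
def step (S : YBE X) (x : X) (g : S.permGroup) : S.permGroup :=
  g * S.σg ((g⁻¹ : Perm X) x)

theorem step_comm (S : YBE X) (x y : X) (g : S.permGroup) :
    S.step x (S.step y g) = S.step y (S.step x g) := by
  refine Subtype.ext ?_
  simp only [step, σg, Subgroup.coe_mul, mul_inv_rev, Perm.mul_apply, mul_assoc]
  rw [S.ybe]

theorem mul_step (S : YBE X) (x : X) (h g : S.permGroup) :
    h * S.step x g = S.step ((h : Perm X) x) (h * g) := by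
  simp [step, mul_assoc]

theorem step_bijective [Finite X] (S : YBE X) (x : X) : Function.Bijective (S.step x) := by
  classical
  have := Fintype.ofFinite X
  have hL : ∀ (l : List X) (h g : S.permGroup),
      h * l.foldr S.step g = (l.map (h : Perm X)).foldr S.step (h * g) := by
    intro l h g
    induction l with
    | nil => rfl
    | cons a l ih => simp only [List.foldr_cons, List.map_cons, mul_step, ih]
  have : LeftCommutative S.step := ⟨fun x y g => S.step_comm x y g⟩
  have hinj : Function.Injective fun g => Finset.univ.toList.foldr S.step g := by
    have hg : ∀ g : S.permGroup,
        Finset.univ.toList.foldr S.step g = g * Finset.univ.toList.foldr S.step 1 := by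
      intro g
      rw [hL, mul_one]
      refine List.Perm.foldr_eq ?_ _
      refine (List.perm_ext_iff_of_nodup (Finset.nodup_toList _)
        ((Finset.nodup_toList _).map (g : Perm X).injective)).2 fun a => ?_
      simp only [Finset.mem_toList, Finset.mem_univ, List.mem_map, true_iff, true_and]
      exact (g : Perm X).surjective a
    intro a b hab
    simp only [hg a, hg b] at hab
    exact mul_right_cancel hab
  refine Function.Injective.bijective_of_finite fun a b hab => hinj ?_
  have hperm : (Finset.univ.toList : List X).Perm (Finset.univ.toList.erase x ++ [x]) :=
    (List.perm_cons_erase (by simp)).trans (List.perm_append_comm (l₁ := [x]))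
  change Finset.univ.toList.foldr S.step a = Finset.univ.toList.foldr S.step b
  rw [hperm.foldr_eq a, hperm.foldr_eq b]
  simp [hab]

/-- `S.step x` as a permutation. -/
noncomputable def stepPerm [Finite X] (S : YBE X) (x : X) : Perm S.permGroup :=
  Equiv.ofBijective _ (S.step_bijective x)

theorem stepPerm_apply [Finite X] (S : YBE X) (x : X) (g : S.permGroup) :
    S.stepPerm x g = S.step x g := rfl

/-- The additive group of the brace `𝒢(X,r)`, written multiplicatively and realised by its regular
representation. -/
def addPerms [Finite X] (S : YBE X) : Subgroup (Perm S.permGroup) :=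
  Subgroup.closure (Set.range S.stepPerm)

theorem addPerms_comm [Finite X] (S : YBE X) (a b : S.addPerms) : a * b = b * a := by
  have := Subgroup.isMulCommutative_closure (k := Set.range S.stepPerm) (by
    rintro _ ⟨x, rfl⟩ _ ⟨y, rfl⟩
    exact Equiv.ext fun g => S.step_comm x y g)
  exact this.is_comm.comm a b

theorem conj_stepPerm [Finite X] (S : YBE X) (g : S.permGroup) (x : X) :
    MulAut.conj (Equiv.mulLeft g) (S.stepPerm x) = S.stepPerm ((g : Perm X) x) := by
  ext1 h
  simp only [MulAut.conj_apply, Perm.mul_apply, stepPerm_apply, Equiv.coe_mulLeft, mul_step]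
  congr 1
  exact (Equiv.mulLeft g).apply_symm_apply h

theorem conj_mem_addPerms [Finite X] (S : YBE X) (g : S.permGroup) {a : Perm S.permGroup}
    (ha : a ∈ S.addPerms) : MulAut.conj (Equiv.mulLeft g) a ∈ S.addPerms := by
  induction ha using Subgroup.closure_induction with
  | mem a ha =>
    obtain ⟨x, rfl⟩ := ha
    rw [conj_stepPerm]
    exact Subgroup.subset_closure ⟨_, rfl⟩
  | one => rw [map_one]; exact one_mem _
  | mul a b _ _ ha hb => rw [map_mul]; exact mul_mem ha hb
  | inv a _ ha => rw [map_inv]; exact inv_mem ha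

theorem exists_mem_addPerms_apply_one [Finite X] (S : YBE X) (g : S.permGroup) :
    ∃ a ∈ S.addPerms, a 1 = g := by
  have key : ∀ (h : Perm X) (hh : h ∈ S.permGroup) (g : S.permGroup),
      (∃ a ∈ S.addPerms, a 1 = g) ↔ ∃ a ∈ S.addPerms, a 1 = g * ⟨h, hh⟩ := by
    intro h hh
    induction hh using Subgroup.closure_induction with
    | mem h hh =>
      obtain ⟨y, rfl⟩ := hh
      intro g
      have hs : S.stepPerm ((g : Perm X) y) ∈ S.addPerms := Subgroup.subset_closure ⟨_, rfl⟩
      have hg : S.stepPerm ((g : Perm X) y) g = g * S.σg y := by simp [stepPerm_apply, step]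
      refine ⟨fun ⟨a, ha, h⟩ => ⟨_, mul_mem hs ha, ?_⟩,
        fun ⟨a, ha, h⟩ => ⟨_, mul_mem (inv_mem hs) ha, ?_⟩⟩
      · rw [Perm.mul_apply, h, hg]; rfl
      · rw [Perm.mul_apply, h, Perm.inv_eq_iff_eq, hg]; rfl
    | one => intro g; rw [show (⟨1, _⟩ : S.permGroup) = 1 from rfl, mul_one]
    | mul a b ha' hb' ha hb =>
      intro g
      rw [ha, hb, mul_assoc]; rfl
    | inv a ha' ha =>
      intro g
      rw [ha (g * _), mul_assoc, show (⟨a⁻¹, _⟩ : S.permGroup) * ⟨a, ha'⟩ = 1 from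
        inv_mul_cancel (⟨a, ha'⟩ : S.permGroup), mul_one]
  have := (key g g.2 1).1 ⟨1, one_mem _, rfl⟩
  rwa [one_mul] at this

theorem addPerms_eval_injective [Finite X] (S : YBE X) {a b : Perm S.permGroup}
    (ha : a ∈ S.addPerms) (hb : b ∈ S.addPerms) (h : a 1 = b 1) : a = b := by
  ext1 g
  obtain ⟨c, hc, rfl⟩ := S.exists_mem_addPerms_apply_one g
  have h1 : a * c = c * a := congrArg Subtype.val (S.addPerms_comm ⟨a, ha⟩ ⟨c, hc⟩)
  have h2 : b * c = c * b := congrArg Subtype.val (S.addPerms_comm ⟨b, hb⟩ ⟨c, hc⟩)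
  rw [← Perm.mul_apply, h1, ← Perm.mul_apply, h2, Perm.mul_apply, Perm.mul_apply, h]

/-- The permutation group of a finite solution is the multiplicative group of a brace: it carries a
bijective cocycle with values in an abelian group. -/
theorem exists_bijective_cocycle [Finite X] (S : YBE X) :
    ∃ (A : Type u) (_ : AddCommGroup A) (_ : DistribMulAction S.permGroup A)
      (π : S.permGroup ≃ A), (∀ g h, π (g * h) = π g + g • π h) ∧
      (∀ (g : S.permGroup) x, g • π (S.σg x) = π (S.σg ((g : Perm X) x))) ∧
      AddSubgroup.closure (Set.range fun x => π (S.σg x)) = ⊤ := by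
  let _ : CommGroup S.addPerms := { mul_comm := S.addPerms_comm }
  let _ : DistribMulAction S.permGroup (Additive S.addPerms) :=
    { smul := fun g a => Additive.ofMul
        ⟨MulAut.conj (Equiv.mulLeft g) a.toMul, S.conj_mem_addPerms g a.toMul.2⟩
      one_smul := fun a => by
        refine Additive.toMul.injective (Subtype.ext (Equiv.ext fun h => ?_))
        change 1 * a.toMul.1 (1⁻¹ * h) = a.toMul.1 h
        simp
      mul_smul := fun g h a => by
        refine Additive.toMul.injective (Subtype.ext (Equiv.ext fun k => ?_))
        change g * h * a.toMul.1 ((g * h)⁻¹ * k) = g * (h * a.toMul.1 (h⁻¹ * (g⁻¹ * k)))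
        simp [mul_assoc]
      smul_add := fun g a b => Additive.toMul.injective (Subtype.ext (map_mul _ _ _))
      smul_zero := fun g => Additive.toMul.injective (Subtype.ext (map_one _)) }
  have hbij : Function.Bijective fun a : Additive S.addPerms => (a.toMul : Perm S.permGroup) 1 :=
    ⟨fun a b h => Additive.toMul.injective
        (Subtype.ext (S.addPerms_eval_injective a.toMul.2 b.toMul.2 h)),
      fun g => let ⟨a, ha, h⟩ := S.exists_mem_addPerms_apply_one g
        ⟨Additive.ofMul ⟨a, ha⟩, h⟩⟩
  have hπ : ∀ x, (Equiv.ofBijective _ hbij).symm (S.σg x) =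
      Additive.ofMul (⟨S.stepPerm x, Subgroup.subset_closure ⟨_, rfl⟩⟩ : S.addPerms) := by
    intro x
    rw [Equiv.symm_apply_eq]
    change _ = S.step x 1
    simp [step]
  refine ⟨Additive S.addPerms, inferInstance, inferInstance, (Equiv.ofBijective _ hbij).symm,
    fun g h => ?_, fun g x => ?_, ?_⟩
  · rw [Equiv.symm_apply_eq]
    set a := (Equiv.ofBijective _ hbij).symm g with ha
    set b := (Equiv.ofBijective _ hbij).symm h with hb
    rw [Equiv.eq_symm_apply] at ha hb
    rw [add_comm]
    change g * h = g * b.toMul.1 (g⁻¹ * a.toMul.1 1)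
    rw [show a.toMul.1 1 = g from ha]
    have : b.toMul.1 1 = h := hb
    simp [this]
  · rw [hπ, hπ]
    exact congrArg Additive.ofMul (Subtype.ext (S.conj_stepPerm g x))
  · rw [eq_top_iff]
    rintro a -
    obtain ⟨a, ha⟩ := a
    have key : ∀ (a : Perm S.permGroup) (ha : a ∈ S.addPerms),
        (Additive.ofMul (⟨a, ha⟩ : S.addPerms)) ∈ AddSubgroup.closure (Set.range fun x =>
          (Equiv.ofBijective _ hbij).symm (S.σg x)) := by
      intro a ha
      induction ha using Subgroup.closure_induction with
      | mem a ha =>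
        obtain ⟨x, rfl⟩ := ha
        exact AddSubgroup.subset_closure ⟨x, hπ x⟩
      | one => exact zero_mem _
      | mul a b _ _ ha hb => exact add_mem ha hb
      | inv a _ ha => exact neg_mem ha
    exact key a ha

end YBE

theorem coprime_card_of_nsmul_eq_zero {A : Type*} [AddCommGroup A] [Finite A] {B : AddSubgroup A}
    {m r : ℕ} (hr : r.Prime) (hm : ¬ r ∣ m) (hB : ∀ b ∈ B, m • b = 0) :
    (Nat.card B).Coprime r := by
  rw [Nat.coprime_comm, hr.coprime_iff_not_dvd]
  intro hd
  have := Fact.mk hr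
  obtain ⟨b, hb⟩ := exists_prime_addOrderOf_dvd_card' r hd
  exact hm (hb ▸ addOrderOf_dvd_of_nsmul_eq_zero (Subtype.ext (hB b b.2)))

theorem exists_card_eq_pow_of_nsmul_eq_zero {A : Type*} [AddCommGroup A] [Finite A]
    {B : AddSubgroup A} {k r : ℕ} (hr : r.Prime) (hB : ∀ b ∈ B, r ^ k • b = 0) :
    ∃ j, Nat.card B = r ^ j := by
  refine ⟨_, Nat.eq_prime_pow_of_unique_prime_dvd Nat.card_pos.ne' fun {s} hs hd => ?_⟩
  by_contra hne
  have h1 := coprime_card_of_nsmul_eq_zero hs (fun h => hne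
    ((Nat.prime_dvd_prime_iff_eq hs hr).1 (hs.dvd_of_dvd_pow h))) hB
  exact hs.one_lt.ne' (Nat.Coprime.eq_one_of_dvd h1.symm hd)

theorem IsPGroup.commutator_smul_eq {P X : Type*} [Group P] [Finite P] [MulAction P X] {r : ℕ}
    (hr : r.Prime) (hP : IsPGroup r P) {x : X} (hx : (MulAction.stabilizer P x).index = 1 ∨
      (MulAction.stabilizer P x).index = r) (a b : P) : (a * b) • x = (b * a) • x := by
  have := Fact.mk hr
  have hmem : (b * a)⁻¹ * (a * b) ∈ MulAction.stabilizer P x → (a * b) • x = (b * a) • x := by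
    intro h
    rw [MulAction.mem_stabilizer_iff, mul_smul, inv_smul_eq_iff] at h
    exact h
  apply hmem
  rcases hx with hx | hx
  · rw [Subgroup.index_eq_one.1 hx]; trivial
  have hnormal : (MulAction.stabilizer P x).Normal := by
    refine Subgroup.normal_of_index_eq_minFac_card ?_
    obtain ⟨n, hn⟩ := IsPGroup.iff_card.1 hP
    rw [hx, hn, hr.pow_minFac]
    rintro rfl
    have := (MulAction.stabilizer P x).index_dvd_card
    rw [hn, hx, pow_zero] at this
    exact hr.one_lt.ne' (Nat.dvd_one.1 this)
  have hc : IsCyclic (P ⧸ MulAction.stabilizer P x) :=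
    isCyclic_of_prime_card (p := r) (by rw [← Subgroup.index_eq_card, hx])
  rw [← QuotientGroup.eq]
  exact hc.isMulCommutative.is_comm.comm (b : P ⧸ MulAction.stabilizer P x) a

section

variable {G : Type v} {A : Type u} [Group G] [AddCommGroup A] [DistribMulAction G A] {π : G ≃ A}

theorem cocycle_one (hπ : ∀ g h, π (g * h) = π g + g • π h) : π 1 = 0 := by
  have := hπ 1 1
  rw [mul_one, one_smul] at this
  simpa using this

theorem cocycle_inv (hπ : ∀ g h, π (g * h) = π g + g • π h) (g : G) : π g⁻¹ = -(g⁻¹ • π g) := by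
  have := hπ g⁻¹ g
  rw [inv_mul_cancel, cocycle_one hπ] at this
  exact eq_neg_of_add_eq_zero_left this.symm

/-- If `g` fixes the value of a bijective cocycle at `h`, then `h⁻¹ * g * h` has the cocycle
value `h⁻¹ • π g`. -/
theorem cocycle_conj (hπ : ∀ g h, π (g * h) = π g + g • π h) {g h : G} (hg : g • π h = π h) :
    π (h⁻¹ * g * h) = h⁻¹ • π g := by
  rw [mul_assoc, hπ, hπ g, hg, cocycle_inv hπ, smul_add]
  abel

theorem cocycle_symm_add (hπ : ∀ g h, π (g * h) = π g + g • π h) (a b : A) :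
    π.symm (a + b) = π.symm a * π.symm ((π.symm a)⁻¹ • b) := by
  rw [Equiv.symm_apply_eq, hπ]
  simp

end

/-- The subgroup cut out by a stable subgroup of values of a bijective cocycle. -/
def cocycleComap {G : Type v} {A : Type u} [Group G] [AddCommGroup A] [DistribMulAction G A]
    {π : G ≃ A} (hπ : ∀ g h, π (g * h) = π g + g • π h) (B : AddSubgroup A)
    (hB : ∀ (g : G), ∀ b ∈ B, g • b ∈ B) : Subgroup G where
  carrier := {g | π g ∈ B}
  mul_mem' {a b} ha hb := by
    change π (a * b) ∈ B
    rw [hπ]; exact add_mem ha (hB _ _ hb)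
  one_mem' := by
    change π 1 ∈ B
    rw [cocycle_one hπ]; exact zero_mem _
  inv_mem' {a} ha := by
    change π a⁻¹ ∈ B
    rw [cocycle_inv hπ]; exact neg_mem (hB _ _ ha)

section

variable {G : Type v} {A : Type u} [Group G] [AddCommGroup A] [DistribMulAction G A] {π : G ≃ A}
  (hπ : ∀ g h, π (g * h) = π g + g • π h)

theorem card_cocycleComap (B : AddSubgroup A) (hB : ∀ (g : G), ∀ b ∈ B, g • b ∈ B) :
    Nat.card (cocycleComap hπ B hB) = Nat.card B :=
  Nat.card_congr (π.subtypeEquiv fun _ => Iff.rfl)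

theorem index_cocycleComap [Finite A] (B : AddSubgroup A) (hB : ∀ (g : G), ∀ b ∈ B, g • b ∈ B) :
    (cocycleComap hπ B hB).index = B.index := by
  have h1 := (cocycleComap hπ B hB).card_mul_index
  rw [card_cocycleComap, Nat.card_congr π, ← B.card_mul_index] at h1
  exact Nat.eq_of_mul_eq_mul_left Nat.card_pos h1

theorem smul_mem_ker_nsmul (k : ℕ) (g : G) (b : A) (hb : b ∈ (nsmulAddMonoidHom (α := A) k).ker) :
    g • b ∈ (nsmulAddMonoidHom (α := A) k).ker := by
  rw [AddMonoidHom.mem_ker, nsmulAddMonoidHom_apply] at hb ⊢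
  rw [← smul_comm, hb, smul_zero]

/-- The subgroup corresponding to the `k`-torsion. -/
def cocycleTorsion (k : ℕ) : Subgroup G :=
  cocycleComap hπ (nsmulAddMonoidHom (α := A) k).ker (smul_mem_ker_nsmul k)

theorem mem_cocycleTorsion {k : ℕ} {g : G} : g ∈ cocycleTorsion hπ k ↔ k • π g = 0 := Iff.rfl

theorem card_cocycleTorsion_coprime [Finite A] {m r : ℕ} (hr : r.Prime) (hm : ¬ r ∣ m) :
    (Nat.card (cocycleTorsion hπ m)).Coprime r := by
  rw [cocycleTorsion, card_cocycleComap]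
  exact coprime_card_of_nsmul_eq_zero hr hm fun b hb => hb

theorem isPGroup_cocycleTorsion [Finite A] {k r : ℕ} (hr : r.Prime) :
    IsPGroup r (cocycleTorsion hπ (r ^ k)) := by
  obtain ⟨j, hj⟩ := exists_card_eq_pow_of_nsmul_eq_zero hr
    (B := (nsmulAddMonoidHom (α := A) (r ^ k)).ker) fun b hb => hb
  exact IsPGroup.of_card ((card_cocycleComap hπ _ _).trans hj)

theorem nsmul_eq_zero_of_mem_range [Finite A] {a b : ℕ} (hA : Nat.card A = a * b) :
    ∀ x ∈ (nsmulAddMonoidHom (α := A) a).range, b • x = 0 := by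
  rintro _ ⟨x, rfl⟩
  rw [nsmulAddMonoidHom_apply, ← mul_nsmul, ← hA, card_nsmul_eq_zero']

theorem exists_index_cocycleTorsion_eq_pow [Finite A] {k m r : ℕ} (hr : r.Prime)
    (hA : Nat.card A = r ^ k * m) : ∃ j, (cocycleTorsion hπ m).index = r ^ j := by
  rw [cocycleTorsion, index_cocycleComap, AddSubgroup.index_ker]
  exact exists_card_eq_pow_of_nsmul_eq_zero hr
    (nsmul_eq_zero_of_mem_range (hA.trans (mul_comm _ _)))

theorem not_dvd_index_cocycleTorsion [Finite A] {k m r : ℕ} (hr : r.Prime) (hm : ¬ r ∣ m)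
    (hA : Nat.card A = r ^ k * m) : ¬ r ∣ (cocycleTorsion hπ (r ^ k)).index := by
  rw [cocycleTorsion, index_cocycleComap, AddSubgroup.index_ker, ← hr.coprime_iff_not_dvd,
    Nat.coprime_comm]
  exact coprime_card_of_nsmul_eq_zero hr hm (nsmul_eq_zero_of_mem_range hA)

theorem isSolvable_of_bijective_cocycle [Finite A] (hπ : ∀ g h, π (g * h) = π g + g • π h) :
    Group.IsSolvable G := by
  have : Finite G := Finite.of_equiv A π.symm
  refine Group.isSolvable_of_exists_complement fun r hr => ?_
  obtain ⟨k, m, hm, hA⟩ := Nat.exists_eq_pow_mul_and_not_dvd (Nat.card_pos (α := A)).ne' r hr.ne_one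
  exact ⟨cocycleTorsion hπ m, card_cocycleTorsion_coprime hπ hr hm,
    exists_index_cocycleTorsion_eq_pow hπ hr hA⟩

/-- The solution on a stable subset of the values of a bijective cocycle. -/
def cocycleYBE (hπ : ∀ g h, π (g * h) = π g + g • π h) (Z : SubMulAction G A) : YBE Z where
  σ z := MulAction.toPerm (π.symm z)
  ybe x y := by
    ext w
    have h1 := cocycle_symm_add hπ (x : A) y
    have h2 := cocycle_symm_add hπ (y : A) x
    rw [add_comm, h1] at h2
    simpa [mul_smul, MulAction.toPerm] using congrArg (· • (w : A)) h2

theorem cocycleYBE_σ_apply (Z : SubMulAction G A) (z w : Z) :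
    (cocycleYBE hπ Z).σ z w = π.symm z • w := rfl

theorem mem_closure_of_mem_addClosure (Z : SubMulAction G A) {g : G}
    (hπ : ∀ g h, π (g * h) = π g + g • π h)
    (hg : π g ∈ AddSubgroup.closure (Z : Set A)) :
    g ∈ Subgroup.closure (π.symm '' Z) := by
  set K := Subgroup.closure (π.symm '' (Z : Set A))
  have key : ∀ a ∈ AddSubgroup.closure (Z : Set A), ∀ b, π.symm b ∈ K ↔ π.symm (b + a) ∈ K := by
    intro a ha
    induction ha using AddSubgroup.closure_induction with
    | mem z hz =>
      intro b
      rw [cocycle_symm_add hπ, K.mul_mem_cancel_right]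
      exact Subgroup.subset_closure ⟨_, Z.smul_mem _ hz, rfl⟩
    | zero => simp
    | add a c _ _ ha hc => intro b; rw [ha, hc, add_assoc]
    | neg a _ ha => intro b; rw [ha (b + -a), neg_add_cancel_right]
  have := (key _ hg 0).1 (by
    rw [← cocycle_one hπ, π.symm_apply_apply]; exact one_mem _)
  rwa [zero_add, π.symm_apply_apply] at this

theorem cocycleYBE_indecomposable (Z : SubMulAction G A) {H : Subgroup G}
    (hH : ∀ h ∈ H, π h ∈ AddSubgroup.closure (Z : Set A))
    (htrans : ∀ x y : Z, ∃ h ∈ H, h • x = y) : (cocycleYBE hπ Z).Indecomposable := by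
  have key : Subgroup.closure (π.symm '' (Z : Set A)) ≤
      (cocycleYBE hπ Z).permGroup.comap (MulAction.toPermHom G Z) := by
    rw [Subgroup.closure_le]
    rintro _ ⟨z, hz, rfl⟩
    exact Subgroup.subset_closure ⟨⟨z, hz⟩, rfl⟩
  intro x y
  obtain ⟨h, hh, hxy⟩ := htrans x y
  exact ⟨_, key (mem_closure_of_mem_addClosure Z hπ (hH h hh)), hxy⟩

end

theorem eq_zero_of_coprime_nsmul {A : Type*} [AddCommGroup A] {q m : ℕ} (h : q.Coprime m) {a : A}
    (hq : q • a = 0) (hm : m • a = 0) : a = 0 :=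
  AddMonoid.addOrderOf_eq_one_iff.1 (Nat.eq_one_of_dvd_coprimes h
    (addOrderOf_dvd_of_nsmul_eq_zero hq) (addOrderOf_dvd_of_nsmul_eq_zero hm))

theorem exists_add_eq_of_coprime_nsmul {A : Type*} [AddCommGroup A] {q m : ℕ} (h : q.Coprime m)
    (hA : Nat.card A = q * m) (a : A) : ∃ b c : A, m • b = 0 ∧ q • c = 0 ∧ b + c = a := by
  obtain ⟨e, f, hef⟩ := Nat.isCoprime_iff_coprime.2 h
  refine ⟨e • q • a, f • m • a, ?_, ?_, ?_⟩
  · rw [← smul_comm, ← mul_nsmul, ← hA, card_nsmul_eq_zero', smul_zero]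
  · rw [← smul_comm, ← mul_nsmul, mul_comm, ← hA, card_nsmul_eq_zero', smul_zero]
  · rw [← natCast_zsmul a q, ← natCast_zsmul a m, ← mul_zsmul, ← mul_zsmul, ← add_zsmul, hef,
      one_zsmul]

theorem IsPGroup.prime_dvd_card_fiber {G X Z : Type*} [Group G] [MulAction G X]
    [MulAction.IsPretransitive G X] [FaithfulSMul G X] [Finite X] {r : ℕ} (hr : r.Prime)
    {N : Subgroup G} [hnormal : N.Normal] (hN : IsPGroup r N) (hne : N ≠ ⊥) {f : X → Z}
    (hf : ∀ n ∈ N, ∀ x, f (n • x) = f x) (z : Z) : r ∣ Nat.card {x // f x = z} := by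
  have := Fact.mk hr
  let F : SubMulAction N X :=
    { carrier := {x | f x = z}
      smul_mem' := fun n x hx => (hf n n.2 x).trans hx }
  refine (hN.card_modEq_card_fixedPoints F).dvd_iff dvd_rfl |>.2 ?_
  have : IsEmpty (MulAction.fixedPoints N F) := by
    refine ⟨fun ⟨x, hx⟩ => hne ((Subgroup.eq_bot_iff_forall _).2 fun n hn => ?_)⟩
    refine FaithfulSMul.eq_of_smul_eq_smul (α := X) fun y => ?_
    obtain ⟨g, rfl⟩ := MulAction.exists_smul_eq G (x : X) y
    have h1 := congrArg Subtype.val (hx ⟨g⁻¹ * n * g, by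
      simpa using hnormal.conj_mem n hn g⁻¹⟩)
    have h2 : (g⁻¹ * n * g) • (x : X) = x := h1
    rw [mul_smul, mul_smul, inv_smul_eq_iff] at h2
    rw [h2, one_smul]
  simp

theorem IsPGroup.mul_comm_of_normal {G X : Type*} [Group G] [Finite G] [MulAction G X]
    [MulAction.IsPretransitive G X] [FaithfulSMul G X] (hsq : Squarefree (Nat.card X))
    {r : ℕ} (hr : r.Prime) {P : Subgroup G} [P.Normal] (hP : IsPGroup r P)
    {a b : G} (ha : a ∈ P) (hb : b ∈ P) : a * b = b * a := by
  refine FaithfulSMul.eq_of_smul_eq_smul (α := X) fun x => ?_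
  refine IsPGroup.commutator_smul_eq hr hP (x := x) ?_ ⟨a, ha⟩ ⟨b, hb⟩
  have := Fact.mk hr
  obtain ⟨n, hn⟩ := IsPGroup.iff_card.1 hP
  obtain ⟨j, -, hj⟩ := (Nat.dvd_prime_pow hr).1
    (hn ▸ (MulAction.stabilizer P x).index_dvd_card)
  have hd : (MulAction.stabilizer P x).index ∣ Nat.card X := by
    rw [MulAction.index_stabilizer]
    exact (MulAction.IsBlock.orbit_of_normal x).ncard_dvd_card (MulAction.nonempty_orbit x)
  rw [hj] at hd ⊢
  rcases Nat.lt_or_ge j 2 with h | h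
  · interval_cases j <;> simp
  · exact absurd (hsq r ((pow_two r ▸ pow_dvd_pow r h).trans hd)) (by simpa using hr.ne_one)

section

variable {G : Type v} {A : Type u} [Group G] [AddCommGroup A] [DistribMulAction G A] {π : G ≃ A}
  (hπ : ∀ g h, π (g * h) = π g + g • π h)

theorem normal_cocycleTorsion {q m : ℕ} (h : q.Coprime m) (hA : Nat.card A = q * m)
    (htriv : ∀ g ∈ cocycleTorsion hπ q, ∀ b : A, m • b = 0 → g • b = b) :
    (cocycleTorsion hπ q).Normal := by
  refine ⟨fun p hp g => ?_⟩
  obtain ⟨b, c, hb, hc, hbc⟩ := exists_add_eq_of_coprime_nsmul h hA (π g⁻¹)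
  have hg := cocycle_symm_add hπ b c
  rw [hbc, π.symm_apply_apply] at hg
  set s := π.symm b with hs
  have hp' : π.symm (s⁻¹ • c) ∈ cocycleTorsion hπ q := by
    rw [mem_cocycleTorsion, π.apply_symm_apply, ← smul_comm, hc, smul_zero]
  have hconj : s⁻¹ * p * s ∈ cocycleTorsion hπ q := by
    rw [mem_cocycleTorsion, cocycle_conj hπ, ← smul_comm, (mem_cocycleTorsion hπ).1 hp, smul_zero]
    exact htriv p hp _ (by simpa [hs] using hb)
  have : g * p * g⁻¹ = (π.symm (s⁻¹ • c))⁻¹ * (s⁻¹ * p * s) * π.symm (s⁻¹ • c) := by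
    rw [← inv_inv g, hg]; group
  rw [this]
  exact mul_mem (mul_mem (inv_mem hp') hconj) hp'

theorem cocycleTorsion_eq_bot [Finite A] {X : Type*} [MulAction G X]
    [MulAction.IsPretransitive G X] [FaithfulSMul G X] (hsq : Squarefree (Nat.card X))
    {v : X → A} (hv : Function.Injective v) (hvG : ∀ (g : G) x, v (g • x) = g • v x)
    {r k m : ℕ} (hr : r.Prime) (h : (r ^ k).Coprime m) (hA : Nat.card A = r ^ k * m)
    (htriv : ∀ g ∈ cocycleTorsion hπ (r ^ k), ∀ b : A, m • b = 0 → g • b = b) :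
    cocycleTorsion hπ (r ^ k) = ⊥ := by
  have : Finite G := Finite.of_equiv A π.symm
  have := Fact.mk hr
  have hP := isPGroup_cocycleTorsion hπ (k := k) hr
  have := normal_cocycleTorsion hπ h hA htriv
  by_contra hne
  let T : SubMulAction (cocycleTorsion hπ (r ^ k)) A :=
    { carrier := {a | r ^ k • a = 0}
      smul_mem' := fun g a ha => by
        change r ^ k • (g : G) • a = 0
        rw [← smul_comm, show r ^ k • a = 0 from ha, smul_zero] }
  have hcard : Nat.card T = Nat.card (cocycleTorsion hπ (r ^ k)) :=
    Nat.card_congr (π.symm.subtypeEquiv fun a => by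
      rw [mem_cocycleTorsion, π.apply_symm_apply]; rfl)
  have hdvd : r ∣ Nat.card T := by
    obtain ⟨n, hn⟩ := IsPGroup.iff_card.1 hP
    rw [hcard, hn]
    refine dvd_pow_self r ?_
    rintro rfl
    exact hne (Subgroup.card_eq_one.1 (by rw [hn, pow_zero]))
  obtain ⟨⟨a, ha⟩, hfix, ha0⟩ := hP.exists_fixed_point_of_prime_dvd_card_of_fixed_point T hdvd
    (a := ⟨0, smul_zero _⟩) fun g => Subtype.ext (smul_zero (g : G))
  have hfix' : ∀ g ∈ cocycleTorsion hπ (r ^ k), g • a = a := fun g hg =>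
    congrArg Subtype.val (hfix ⟨g, hg⟩)
  have hc : π.symm a ∈ cocycleTorsion hπ (r ^ k) := by
    rw [mem_cocycleTorsion, π.apply_symm_apply]; exact ha
  have hcb : ∀ b : A, r ^ k • b = 0 → π.symm a • b = b := by
    intro b hb
    have hb' : π.symm b ∈ cocycleTorsion hπ (r ^ k) := by
      rw [mem_cocycleTorsion, π.apply_symm_apply]; exact hb
    have h1 := congrArg π (hP.mul_comm_of_normal hsq hr hc hb')
    rw [hπ, hπ, π.apply_symm_apply, π.apply_symm_apply, hfix' _ hb', add_comm b] at h1
    exact add_left_cancel h1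
  have hc1 : π.symm a = 1 := by
    refine FaithfulSMul.eq_of_smul_eq_smul (α := X) fun x => hv ?_
    obtain ⟨b, c, hb, hc', hbc⟩ := exists_add_eq_of_coprime_nsmul h hA (v x)
    rw [hvG, one_smul, ← hbc, smul_add, htriv _ hc b hb, hcb c hc']
  have ha1 : a = 0 := by rw [← π.apply_symm_apply a, hc1, cocycle_one hπ]
  exact ha0 (Subtype.ext ha1.symm)

/-- A normal `r`-subgroup acts trivially on the prime-to-`r` torsion. -/
theorem smul_eq_of_normal_isPGroup [Finite A] {r k m : ℕ} (hr : r.Prime) (hm : ¬ r ∣ m)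
    (hA : Nat.card A = r ^ k * m) {N : Subgroup G} [hnormal : N.Normal]
    (hπ : ∀ g h, π (g * h) = π g + g • π h) (hN : IsPGroup r N) {n : G} (hn : n ∈ N) {b : A}
    (hb : m • b = 0) : n • b = b := by
  have : Finite G := Finite.of_equiv A π.symm
  have hle : N ≤ cocycleTorsion hπ (r ^ k) :=
    Subgroup.le_of_normal_isPGroup hr hN (not_dvd_index_cocycleTorsion hπ hr hm hA)
  set h := π.symm b
  have h1 : h⁻¹ * n * h ∈ N := by simpa using hnormal.conj_mem n hn h⁻¹
  have h2 : π n + n • b = b + h • π (h⁻¹ * n * h) := by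
    rw [← π.apply_symm_apply b, ← hπ, ← hπ]
    congr 1
    change n * h = h * (h⁻¹ * n * h)
    group
  have h3 : n • b - b = h • π (h⁻¹ * n * h) - π n := by
    rw [sub_eq_sub_iff_add_eq_add, add_comm, h2, add_comm]
  refine sub_eq_zero.1 (eq_zero_of_coprime_nsmul
    (((hr.coprime_iff_not_dvd.2 hm).pow_left k)) ?_ ?_)
  · rw [h3, smul_sub, ← smul_comm, (mem_cocycleTorsion hπ).1 (hle h1),
      (mem_cocycleTorsion hπ).1 (hle hn), smul_zero, sub_zero]
  · rw [smul_sub, ← smul_comm, hb, smul_zero, sub_zero]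

end

/-- A bijective cocycle together with an equivariant embedding of a transitive faithful set of
square-free cardinality onto generators yields a smaller irretractable indecomposable solution. -/
theorem exists_irretractable_of_bijective_cocycle {G : Type v} {A : Type u} [Group G]
    [AddCommGroup A] [Finite A] [DistribMulAction G A] {π : G ≃ A}
    (hπ : ∀ g h, π (g * h) = π g + g • π h) {X : Type*} [Finite X] [MulAction G X]
    [MulAction.IsPretransitive G X] [FaithfulSMul G X] (hsq : Squarefree (Nat.card X))
    (hX : 1 < Nat.card X) {v : X → A} (hv : Function.Injective v)
    (hvG : ∀ (g : G) x, v (g • x) = g • v x) (hspan : AddSubgroup.closure (Set.range v) = ⊤) :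
    ∃ (Z : Type u) (S : YBE Z), Finite Z ∧ S.Indecomposable ∧ Squarefree (Nat.card Z) ∧
      1 < Nat.card Z ∧ Nat.card Z < Nat.card X ∧ Function.Injective S.σ := by
  by_contra! hN
  have : Finite G := Finite.of_equiv A π.symm
  have : Group.IsSolvable G := isSolvable_of_bijective_cocycle hπ
  have : Nonempty X := (Nat.card_pos_iff.1 (zero_lt_one.trans hX)).1
  have : Nontrivial G := by
    obtain ⟨x, y, hxy⟩ := (Finite.one_lt_card_iff_nontrivial.1 hX).exists_pair_ne
    obtain ⟨g, rfl⟩ := MulAction.exists_smul_eq G x y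
    exact ⟨g, 1, fun h => hxy (by rw [h, one_smul])⟩
  obtain ⟨r, N, hr, hnormal, hne, hNr⟩ := Group.IsSolvable.exists_normal_isPGroup (G := G)
  obtain ⟨k, m, hm, hA⟩ := Nat.exists_eq_pow_mul_and_not_dvd (Nat.card_pos (α := A)).ne' r hr.ne_one
  have := Fact.mk hr
  have hco : (r ^ k).Coprime m := (hr.coprime_iff_not_dvd.2 hm).pow_left k
  have hmw : ∀ a : A, m • r ^ k • a = 0 := fun a => by
    rw [← mul_nsmul, ← hA, card_nsmul_eq_zero']
  let Z : SubMulAction G A :=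
    { carrier := Set.range fun x => r ^ k • v x
      smul_mem' := by
        rintro g _ ⟨x, rfl⟩
        exact ⟨g • x, by rw [← smul_comm, ← hvG]⟩ }
  have hspan' : ∀ b : A, m • b = 0 → b ∈ AddSubgroup.closure (Z : Set A) := by
    intro b hb
    have h1 : (Z : Set A) = nsmulAddMonoidHom (α := A) (r ^ k) '' Set.range v := by
      rw [← Set.range_comp]; rfl
    rw [h1, ← AddMonoidHom.map_closure, hspan]
    obtain ⟨e, f, hef⟩ := Nat.isCoprime_iff_coprime.2 hco
    refine ⟨e • b, trivial, ?_⟩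
    have h2 : (e * ((r ^ k : ℕ) : ℤ) + f * (m : ℤ)) • b = b := by rw [hef, one_zsmul]
    rw [add_zsmul, mul_zsmul, mul_zsmul, natCast_zsmul, natCast_zsmul, hb, smul_zero,
      add_zero] at h2
    rw [nsmulAddMonoidHom_apply, ← smul_comm, h2]
  let w : X → Z := fun x => ⟨r ^ k • v x, x, rfl⟩
  have hwG : ∀ (g : G) x, w (g • x) = g • w x := fun g x =>
    Subtype.ext (by change r ^ k • v (g • x) = g • r ^ k • v x; rw [hvG, ← smul_comm])
  have hw : Function.Surjective w := by
    rintro ⟨_, x, rfl⟩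
    exact ⟨x, rfl⟩
  have hpre : MulAction.IsPretransitive G Z := by
    refine ⟨fun a b => ?_⟩
    obtain ⟨x, rfl⟩ := hw a
    obtain ⟨y, rfl⟩ := hw b
    obtain ⟨g, rfl⟩ := MulAction.exists_smul_eq G x y
    exact ⟨g, (hwG g x).symm⟩
  obtain ⟨x₀⟩ := ‹Nonempty X›
  have hcard := MulAction.exists_card_eq_mul_card_fiber (G := G) hw
    (fun g a b hab => by rw [hwG, hwG, hab]) (w x₀)
  have hfib : r ∣ Nat.card {x // w x = w x₀} := by
    refine hNr.prime_dvd_card_fiber hr hne (fun n hn x => ?_) _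
    rw [hwG]
    exact Subtype.ext (smul_eq_of_normal_isPGroup hr hm hA hπ hNr hn (hmw _))
  have hrZ : ¬ r ∣ Nat.card Z := fun hd => by
    have := hsq r (hcard ▸ mul_dvd_mul hd hfib)
    exact hr.one_lt.ne' (by simpa using this)
  have hZsq : Squarefree (Nat.card Z) := hsq.squarefree_of_dvd (Dvd.intro _ hcard.symm)
  have hZX : Nat.card Z < Nat.card X := by
    have h1 : 0 < Nat.card {x // w x = w x₀} := Nat.pos_of_ne_zero fun h0 => by
      rw [hcard, h0, mul_zero] at hX; exact absurd hX (by decide)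
    have h2 := hr.two_le.trans (Nat.le_of_dvd h1 hfib)
    have h3 : 0 < Nat.card Z := Nat.pos_of_ne_zero fun h0 => hrZ (h0 ▸ dvd_zero r)
    nlinarith
  obtain ⟨j, hj⟩ := exists_index_cocycleTorsion_eq_pow hπ hr hA
  have hT : (cocycleYBE hπ Z).Indecomposable := by
    refine cocycleYBE_indecomposable hπ Z (H := cocycleTorsion hπ m)
      (fun h hh => hspan' _ hh) fun x y => ?_
    refine MulAction.exists_mem_smul_eq_of_coprime_index ?_ x y
    rw [hj]
    exact (hr.coprime_iff_not_dvd.2 hrZ).pow_left j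
  have hP := isPGroup_cocycleTorsion hπ (k := k) hr
  have hY : {z : Z | ∀ g ∈ cocycleTorsion hπ (r ^ k), g • z = z} = Set.univ := by
    refine YBE.closed_eq_univ (fun Y S _ h1 h2 h3 h4 h5 => ?_) hT hZsq hZX ?_ ?_
    · exact hN Y S ‹_› h1 h2 h3 h4 h5
    · obtain ⟨z, hz⟩ := hP.nonempty_fixed_point_of_prime_not_dvd_card Z hrZ
      exact ⟨z, fun g hg => hz ⟨g, hg⟩⟩
    · intro x hx y hy g hg
      rw [cocycleYBE_σ_apply, ← mul_smul,
        show g * π.symm x = π.symm x * ((π.symm x)⁻¹ * g * π.symm x) by group, mul_smul, hy]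
      rw [mem_cocycleTorsion, cocycle_conj hπ, ← smul_comm, (mem_cocycleTorsion hπ).1 hg, smul_zero]
      rw [π.apply_symm_apply]
      exact congrArg Subtype.val (hx g hg)
  have htriv : ∀ g ∈ cocycleTorsion hπ (r ^ k), ∀ b : A, m • b = 0 → g • b = b := by
    intro g hg b hb
    have hle : AddSubgroup.closure (Z : Set A) ≤
        (DistribSMul.toAddMonoidHom A g).eqLocus (AddMonoidHom.id A) :=
      (AddSubgroup.closure_le _).2 fun z hz =>
        congrArg Subtype.val (Set.eq_univ_iff_forall.1 hY ⟨z, hz⟩ g hg)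
    exact hle (hspan' b hb)
  refine hne (le_bot_iff.1 ?_)
  rw [← cocycleTorsion_eq_bot hπ hsq hv hvG hr hco hA htriv]
  exact Subgroup.le_of_normal_isPGroup hr hNr (not_dvd_index_cocycleTorsion hπ hr hm hA)

theorem YBE.not_injective_σ {X : Type u} (S : YBE X) [Finite X] (hS : S.Indecomposable)
    (hsq : Squarefree (Nat.card X)) (hX : 1 < Nat.card X) : ¬ Function.Injective S.σ := by
  induction hn : Nat.card X using Nat.strong_induction_on generalizing X with
  | _ n ih =>
    subst hn
    intro hinj
    obtain ⟨A, _, _, π, hπ, hπσ, hspan⟩ := S.exists_bijective_cocycle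
    have := hS.isPretransitive
    have : Finite A := Finite.of_equiv _ π
    obtain ⟨Z, T, hZ, hT, h1, h2, h3, h4⟩ := exists_irretractable_of_bijective_cocycle hπ hsq hX
      (v := fun x => π (S.σg x))
      (fun x y h => hinj (congrArg Subtype.val (π.injective h)))
      (fun g x => (hπσ g x).symm) hspan
    exact ih _ h3 T hT h1 h2 rfl h4

/-- An indecomposable involutive non-degenerate set-theoretic solution of the
YBE of square-free cardinality `p 0 ⋯ p (n-1)` (`p i` distinct primes) is a multipermutation
solution. -/
theorem statement0 {n : ℕ} {X : Type u} (p : Fin n → ℕ)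
    (hp : ∀ i, Nat.Prime (p i)) (hinj : Function.Injective p)
    (S : YBE X) (hcard : Nat.card X = Finset.univ.prod p)
    (hind : S.Indecomposable) :
    S.IsMultipermutation := by
  have hpos : 0 < Nat.card X := hcard ▸ Finset.prod_pos fun i _ => (hp i).pos
  obtain ⟨_, _⟩ := Nat.card_pos_iff.1 hpos
  have hsq : Squarefree (Nat.card X) := by
    rw [hcard]
    refine Finset.squarefree_prod_of_pairwise_isCoprime (fun i _ j _ hij => ?_)
      fun i _ => (hp i).squarefree
    exact Nat.coprime_iff_isRelPrime.1 ((Nat.coprime_primes (hp i) (hp j)).2 (hinj.ne hij))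
  obtain ⟨k, hk⟩ := YBE.exists_mpLevelLE (fun Y T _ h1 h2 h3 => T.not_injective_σ h1 h2 h3) hind hsq
  exact ⟨k + 1, k.succ_pos, hk.succ⟩
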